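/- arXiv:2106.04002 — 2 statements merged into one kernel-verified Lean document; each statement's English description precedes it below -/
import Mathlib

section
/- Let 1 ≤ p < ∞ and let K ⊆ 𝕋 be compact such that either m(K) > 0 and K contains no compact subset of positive arc length measure satisfying Carleson's condition, or m(K) = 0. For every g ∈ A^p(𝔻), every continuous function φ on K and every ε > 0, there exists a complex polynomial P such that ‖P − g‖_{A^p} < ε and sup_{ζ∈K} |P(ζ) − φ(ζ)| < ε. -/
open Complex Metric Set Filter MeasureTheory Polynomial Topology

noncomputable section

/-- The Hardy `p`-norm of a function `f` on the unit disk: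
`sup_{0<r<1} ((1/2π) ∫_0^{2π} |f(r e^{iθ})|^p dθ)^{1/p}`. -/
def hardyNorm (p : ℝ) (f : ℂ → ℂ) : ℝ :=
  ⨆ r : Set.Ioo (0:ℝ) 1,
    ((1 / (2 * Real.pi)) *
      ∫ θ in (0:ℝ)..(2 * Real.pi),
        ‖f (((r : ℝ) : ℂ) * Complex.exp ((θ : ℂ) * Complex.I))‖ ^ p) ^ (1 / p)

/-- Membership in the Hardy space `H^p(𝔻)`: `f` is holomorphic on the unit disk and the
means `((1/2π) ∫_0^{2π} |f(r e^{iθ})|^p dθ)^{1/p}` are uniformly bounded for `0 < r < 1`. -/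
def MemHp (p : ℝ) (f : ℂ → ℂ) : Prop :=
  DifferentiableOn ℂ f (Metric.ball (0:ℂ) 1) ∧
  BddAbove (Set.range fun r : Set.Ioo (0:ℝ) 1 =>
    ((1 / (2 * Real.pi)) *
      ∫ θ in (0:ℝ)..(2 * Real.pi),
        ‖f (((r : ℝ) : ℂ) * Complex.exp ((θ : ℂ) * Complex.I))‖ ^ p) ^ (1 / p))

/-- The Hardy space `H^p(𝔻)` as a type. -/
def HpSpace (p : ℝ) := {f : ℂ → ℂ // MemHp p f}

/-- The norm topology on `H^p(𝔻)`, generated by the open balls of the Hardy norm. -/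
instance hpTopology (p : ℝ) : TopologicalSpace (HpSpace p) :=
  TopologicalSpace.generateFrom
    {U : Set (HpSpace p) | ∃ (f : HpSpace p) (ε : ℝ), 0 < ε ∧
      U = {g : HpSpace p | hardyNorm p (fun z => g.1 z - f.1 z) < ε}}

/-- The arc length measure of a subset `K` of the unit circle `𝕋 ⊆ ℂ`, computed as the
Lebesgue measure of the set of angles `θ ∈ [0, 2π)` with `e^{iθ} ∈ K`. -/
def arcMeasure (K : Set ℂ) : ENNReal :=
  MeasureTheory.volume {θ : ℝ | θ ∈ Set.Ico (0:ℝ) (2 * Real.pi) ∧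
    Complex.exp ((θ : ℂ) * Complex.I) ∈ K}

/-- The Bergman `p`-norm of `f` on the unit disk, with respect to normalised area measure. -/
def bergmanNorm (p : ℝ) (f : ℂ → ℂ) : ℝ :=
  ((Real.pi)⁻¹ * ∫ z in Metric.ball (0:ℂ) 1, ‖f z‖ ^ p) ^ (1 / p)

/-- Membership in the Bergman space `A^p(𝔻)`: `f` is holomorphic on the unit disk and
`|f|^p` is integrable there. -/
def MemAp (p : ℝ) (f : ℂ → ℂ) : Prop :=
  DifferentiableOn ℂ f (Metric.ball (0:ℂ) 1) ∧
  MeasureTheory.IntegrableOn (fun z => ‖f z‖ ^ p) (Metric.ball (0:ℂ) 1)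

/-- The Bergman space `A^p(𝔻)` as a type. -/
def ApSpace (p : ℝ) := {f : ℂ → ℂ // MemAp p f}

/-- The norm topology on `A^p(𝔻)`, generated by the open balls of the Bergman norm. -/
instance apTopology (p : ℝ) : TopologicalSpace (ApSpace p) :=
  TopologicalSpace.generateFrom
    {U : Set (ApSpace p) | ∃ (f : ApSpace p) (ε : ℝ), 0 < ε ∧
      U = {g : ApSpace p | bergmanNorm p (fun z => g.1 z - f.1 z) < ε}}

/-- A subset of the unit circle is an open subarc if it is the image under `θ ↦ e^{iθ}` of a
nonempty open interval of length at most `2π`. -/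
def IsOpenArc (B : Set ℂ) : Prop :=
  ∃ a b : ℝ, a < b ∧ b ≤ a + 2 * Real.pi ∧
    B = (fun θ : ℝ => Complex.exp ((θ : ℂ) * Complex.I)) '' Set.Ioo a b

/-- A compact subset `E` of the unit circle (of positive arc length) satisfies Carleson's
condition if, writing `𝕋 \ E` as a disjoint union of open subarcs `B k`, one has
`Σ_k m(B_k) log(1/m(B_k)) < ∞`. -/
def SatisfiesCarleson (E : Set ℂ) : Prop :=
  ∃ B : ℕ → Set ℂ, (∀ k, IsOpenArc (B k) ∨ B k = ∅) ∧
    Pairwise (Function.onFun Disjoint B) ∧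
    Metric.sphere (0:ℂ) 1 \ E = ⋃ k, B k ∧
    Summable (fun k =>
      (arcMeasure (B k)).toReal * Real.log (1 / (arcMeasure (B k)).toReal))

/-- The admissibility condition on `K ⊆ 𝕋` for the Bergman space results: either `m(K) > 0`
and `K` contains no compact subset of positive arc length satisfying Carleson's condition, or
`m(K) = 0`. -/
def BergmanAdmissible (K : Set ℂ) : Prop :=
  (arcMeasure K ≠ 0 ∧
    ∀ E : Set ℂ, E ⊆ K → IsCompact E → arcMeasure E ≠ 0 → ¬ SatisfiesCarleson E) ∨
  arcMeasure K = 0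

/-- The truncated dyadic capacity of the node `(k, j)`: the largest mass that can be sent from it
to the nodes `d` levels below satisfying `Fr` when a node of level `k` carries at most `k / 2 ^ k`. -/
def dyadicCap (Fr : ℕ → ℕ → Prop) : ℕ → ℕ → ℕ → ℝ
  | 0, k, j => open Classical in if Fr k j then (k : ℝ) / 2 ^ k else 0
  | d + 1, k, j => min ((k : ℝ) / 2 ^ k)
      (dyadicCap Fr d (k + 1) (2 * j) + dyadicCap Fr d (k + 1) (2 * j + 1))

/-- The limit of the truncated capacities as the depth tends to infinity. -/
def dyadicCapLim (Fr : ℕ → ℕ → Prop) (k j : ℕ) : ℝ := ⨆ d, dyadicCap Fr d k j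

/-- A predicate on dyadic nodes that passes to both children. -/
def Hereditary (Fr : ℕ → ℕ → Prop) : Prop :=
  ∀ k j, Fr k j → Fr (k + 1) (2 * j) ∧ Fr (k + 1) (2 * j + 1)

lemma dyadicCap_le (Fr : ℕ → ℕ → Prop) (d k j : ℕ) : dyadicCap Fr d k j ≤ (k : ℝ) / 2 ^ k := by
  cases d with
  | zero =>
    rw [dyadicCap]
    split_ifs
    · exact le_rfl
    · positivity
  | succ d =>
    rw [dyadicCap]
    exact min_le_left _ _

lemma dyadicCap_nonneg (Fr : ℕ → ℕ → Prop) (d k j : ℕ) : 0 ≤ dyadicCap Fr d k j := by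
  induction d generalizing k j with
  | zero =>
    rw [dyadicCap]
    split_ifs
    · positivity
    · exact le_rfl
  | succ d ih =>
    rw [dyadicCap]
    exact le_min (by positivity) (add_nonneg (ih _ _) (ih _ _))

lemma div_two_pow_le_children (k : ℕ) :
    (k : ℝ) / 2 ^ k ≤ ((k + 1 : ℕ) : ℝ) / 2 ^ (k + 1) + ((k + 1 : ℕ) : ℝ) / 2 ^ (k + 1) := by
  have : ((k + 1 : ℕ) : ℝ) / 2 ^ (k + 1) + ((k + 1 : ℕ) : ℝ) / 2 ^ (k + 1)
      = (k : ℝ) / 2 ^ k + 1 / 2 ^ k := by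
    push_cast
    field_simp
    ring
  rw [this]
  have : (0 : ℝ) < 1 / 2 ^ k := by positivity
  linarith

lemma dyadicCap_of_free {Fr : ℕ → ℕ → Prop} (hFr : Hereditary Fr) (d k j : ℕ) (h : Fr k j) :
    dyadicCap Fr d k j = (k : ℝ) / 2 ^ k := by
  induction d generalizing k j with
  | zero => rw [dyadicCap, if_pos h]
  | succ d ih =>
    rw [dyadicCap, ih _ _ (hFr k j h).1, ih _ _ (hFr k j h).2]
    exact min_eq_left (div_two_pow_le_children k)

lemma dyadicCap_mono {Fr : ℕ → ℕ → Prop} (hFr : Hereditary Fr) (k j : ℕ) :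
    Monotone fun d => dyadicCap Fr d k j := by
  refine monotone_nat_of_le_succ fun d => ?_
  induction d generalizing k j with
  | zero =>
    by_cases h : Fr k j
    · rw [dyadicCap_of_free hFr _ _ _ h, dyadicCap_of_free hFr _ _ _ h]
    · calc dyadicCap Fr 0 k j = 0 := by rw [dyadicCap, if_neg h]
        _ ≤ _ := dyadicCap_nonneg _ _ _ _
  | succ d ih =>
    rw [dyadicCap, dyadicCap]
    exact min_le_min le_rfl (add_le_add (ih _ _) (ih _ _))

lemma bddAbove_dyadicCap (Fr : ℕ → ℕ → Prop) (k j : ℕ) :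
    BddAbove (range fun d => dyadicCap Fr d k j) :=
  ⟨(k : ℝ) / 2 ^ k, by rintro _ ⟨d, rfl⟩; exact dyadicCap_le _ _ _ _⟩

lemma tendsto_dyadicCap {Fr : ℕ → ℕ → Prop} (hFr : Hereditary Fr) (k j : ℕ) :
    Tendsto (fun d => dyadicCap Fr d k j) atTop (𝓝 (dyadicCapLim Fr k j)) :=
  tendsto_atTop_ciSup (dyadicCap_mono hFr k j) (bddAbove_dyadicCap Fr k j)

lemma dyadicCapLim_eq {Fr : ℕ → ℕ → Prop} (hFr : Hereditary Fr) (k j : ℕ) :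
    dyadicCapLim Fr k j = min ((k : ℝ) / 2 ^ k)
      (dyadicCapLim Fr (k + 1) (2 * j) + dyadicCapLim Fr (k + 1) (2 * j + 1)) := by
  refine tendsto_nhds_unique ((tendsto_dyadicCap hFr k j).comp (tendsto_add_atTop_nat 1)) ?_
  exact tendsto_const_nhds.min ((tendsto_dyadicCap hFr _ _).add (tendsto_dyadicCap hFr _ _))

lemma dyadicCapLim_le (Fr : ℕ → ℕ → Prop) (k j : ℕ) : dyadicCapLim Fr k j ≤ (k : ℝ) / 2 ^ k :=
  ciSup_le fun _ => dyadicCap_le _ _ _ _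

lemma dyadicCapLim_of_free {Fr : ℕ → ℕ → Prop} (hFr : Hereditary Fr) (k j : ℕ) (h : Fr k j) :
    dyadicCapLim Fr k j = (k : ℝ) / 2 ^ k := by
  simp [dyadicCapLim, dyadicCap_of_free hFr _ _ _ h]

/-- The flow of mass `M` down the dyadic tree which fills left children first, up to the
capacity `c`. -/
def dyadicFlow (c : ℕ → ℕ → ℝ) (M : ℝ) : ℕ → ℕ → ℝ
  | 0, _ => M
  | k + 1, j =>
    if j % 2 = 0 then min (dyadicFlow c M k (j / 2)) (c (k + 1) j)
    else dyadicFlow c M k (j / 2) - min (dyadicFlow c M k (j / 2)) (c (k + 1) (j - 1))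

lemma dyadicFlow_even (c : ℕ → ℕ → ℝ) (M : ℝ) (k j : ℕ) :
    dyadicFlow c M (k + 1) (2 * j) = min (dyadicFlow c M k j) (c (k + 1) (2 * j)) := by
  rw [dyadicFlow, if_pos (by omega), Nat.mul_div_cancel_left _ two_pos]

lemma dyadicFlow_odd (c : ℕ → ℕ → ℝ) (M : ℝ) (k j : ℕ) :
    dyadicFlow c M (k + 1) (2 * j + 1)
      = dyadicFlow c M k j - min (dyadicFlow c M k j) (c (k + 1) (2 * j)) := by
  rw [dyadicFlow, if_neg (by omega), show (2 * j + 1) / 2 = j by omega, Nat.add_sub_cancel]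

lemma dyadicFlow_add (c : ℕ → ℕ → ℝ) (M : ℝ) (k j : ℕ) :
    dyadicFlow c M k j = dyadicFlow c M (k + 1) (2 * j) + dyadicFlow c M (k + 1) (2 * j + 1) := by
  rw [dyadicFlow_even, dyadicFlow_odd]
  ring

/-- Induction over the nodes of the dyadic tree. -/
lemma dyadic_induction {P : ℕ → ℕ → Prop} (h0 : P 0 0)
    (hs : ∀ k j, j < 2 ^ k → P k j → P (k + 1) (2 * j) ∧ P (k + 1) (2 * j + 1))
    (k j : ℕ) (hj : j < 2 ^ k) : P k j := by
  induction k generalizing j with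
  | zero =>
    obtain rfl : j = 0 := by simpa using hj
    exact h0
  | succ k ih =>
    rw [pow_succ] at hj
    have h2 := hs k (j / 2) (by omega) (ih (j / 2) (by omega))
    rcases Nat.mod_two_eq_zero_or_one j with h | h
    · have : 2 * (j / 2) = j := by omega
      rw [this] at h2
      exact h2.1
    · have : 2 * (j / 2) + 1 = j := by omega
      rw [this] at h2
      exact h2.2

lemma dyadicFlow_bounds {c : ℕ → ℕ → ℝ} {M : ℝ} (hM : 0 ≤ M) (hM0 : M ≤ c 0 0)
    (hc0 : ∀ k j, j < 2 ^ k → 0 ≤ c k j)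
    (hc : ∀ k j, j < 2 ^ k → c k j ≤ c (k + 1) (2 * j) + c (k + 1) (2 * j + 1))
    (k j : ℕ) (hj : j < 2 ^ k) : 0 ≤ dyadicFlow c M k j ∧ dyadicFlow c M k j ≤ c k j := by
  refine dyadic_induction (P := fun k j => 0 ≤ dyadicFlow c M k j ∧ dyadicFlow c M k j ≤ c k j)
    ⟨hM, hM0⟩ (fun k j hj h => ?_) k j hj
  have h1 := hc0 (k + 1) (2 * j) (by rw [pow_succ]; omega)
  have h2 := hc0 (k + 1) (2 * j + 1) (by rw [pow_succ]; omega)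
  have h3 := hc k j hj
  rw [dyadicFlow_even, dyadicFlow_odd]
  rcases le_total (dyadicFlow c M k j) (c (k + 1) (2 * j)) with h4 | h4
  · rw [min_eq_left h4]
    exact ⟨⟨h.1, h4⟩, by linarith, by linarith⟩
  · rw [min_eq_right h4]
    exact ⟨⟨h1, le_rfl⟩, by linarith, by linarith [h.2]⟩

/-- If the limit capacities are maximal from level one on, mass `M` can be distributed over the
dyadic tree, uniformly down to level `n`, with level-`k` masses at most `(M + δ k) / 2 ^ k` and
without charging the nodes of some level which fail `Fr`. -/
lemma exists_dyadic_mass {Fr : ℕ → ℕ → Prop} (hFr : Hereditary Fr)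
    (hsat : ∀ k j, 1 ≤ k → dyadicCapLim Fr k j = (k : ℝ) / 2 ^ k)
    {M δ : ℝ} (hM : 0 < M) (hδ : 0 < δ) {n : ℕ} (hn : M < δ * n) :
    ∃ (N : ℕ) (μ : ℕ → ℕ → ℝ), (∀ k j, j < 2 ^ k → 0 ≤ μ k j) ∧
      (∀ k j, μ k j = μ (k + 1) (2 * j) + μ (k + 1) (2 * j + 1)) ∧
      (∀ k j, k ≤ n → j < 2 ^ k → μ k j = M / 2 ^ k) ∧
      (∀ k j, j < 2 ^ k → μ k j ≤ (M + δ * k) / 2 ^ k) ∧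
      (∀ j, j < 2 ^ N → ¬ Fr N j → μ N j = 0) := by
  have hn1 : 1 ≤ n := by
    rcases Nat.eq_zero_or_pos n with h | h
    · simp [h] at hn; linarith
    · exact h
  have hex : ∀ j, ∃ d, M / 2 ^ n < δ * dyadicCap Fr d n j := by
    intro j
    have h1 : Tendsto (fun d => δ * dyadicCap Fr d n j) atTop (𝓝 (δ * ((n : ℝ) / 2 ^ n))) := by
      have := tendsto_dyadicCap hFr n j
      rw [hsat n j hn1] at this
      exact this.const_mul δ
    have h2 : M / 2 ^ n < δ * ((n : ℝ) / 2 ^ n) := by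
      rw [← mul_div_assoc]
      gcongr
    exact (h1.eventually (lt_mem_nhds h2)).exists
  choose D hD using hex
  obtain ⟨d, hd⟩ : ∃ d, ∀ j < 2 ^ n, D j ≤ d :=
    ⟨(Finset.range (2 ^ n)).sup D, fun j hj => Finset.le_sup (Finset.mem_range.2 hj)⟩
  let N := n + 1 + d
  let c : ℕ → ℕ → ℝ := fun k j => if k ≤ n then M / 2 ^ k else δ * dyadicCap Fr (N - k) k j
  have hcle : ∀ k j, k ≤ n → c k j = M / 2 ^ k := fun k j h => if_pos h
  have hcgt : ∀ k j, n < k → c k j = δ * dyadicCap Fr (N - k) k j := fun k j h =>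
    if_neg (by omega)
  have hc0 : ∀ k j, j < 2 ^ k → 0 ≤ c k j := by
    intro k j _
    rcases le_or_gt k n with h | h
    · rw [hcle k j h]; positivity
    · rw [hcgt k j h]; exact mul_nonneg hδ.le (dyadicCap_nonneg _ _ _ _)
  have hcs : ∀ k j, j < 2 ^ k → c k j ≤ c (k + 1) (2 * j) + c (k + 1) (2 * j + 1) := by
    intro k j hj
    rcases lt_trichotomy k n with h | h | h
    · rw [hcle k j h.le, hcle _ _ h, hcle _ _ h, pow_succ]
      apply le_of_eq
      field_simp
      norm_num
    · subst h
      rw [hcle k j le_rfl, hcgt _ _ (by omega), hcgt _ _ (by omega), ← mul_add]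
      have h1 := dyadicCap_mono hFr k j (show D j ≤ d + 1 from (hd j hj).trans (by omega))
      have h2 : dyadicCap Fr (d + 1) k j ≤ _ := (min_le_right _ _)
      rw [show N - (k + 1) = d by simp [N]]
      exact (hD j).le.trans (by gcongr; exact h1.trans h2)
    · rw [hcgt k j h, hcgt _ _ (by omega), hcgt _ _ (by omega), ← mul_add]
      gcongr
      rcases le_or_gt N k with hN | hN
      · rw [Nat.sub_eq_zero_of_le hN, Nat.sub_eq_zero_of_le (by omega)]
        refine (dyadicCap_mono hFr k j (Nat.zero_le 1)).trans (min_le_right _ _)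
      · obtain ⟨q, hq⟩ : ∃ q, N - k = q + 1 := ⟨N - k - 1, by omega⟩
        rw [hq, show N - (k + 1) = q by omega]
        exact min_le_right _ _
  have hbd := dyadicFlow_bounds hM.le (by simp [hcle 0 0]) hc0 hcs
  refine ⟨N, dyadicFlow c M, fun k j hj => (hbd k j hj).1, dyadicFlow_add c M, ?_, ?_, ?_⟩
  · intro k j hk hj
    induction k generalizing j with
    | zero => simp [dyadicFlow]
    | succ k ih =>
      rw [pow_succ] at hj
      have h1 := ih (j / 2) (by omega) (by omega)
      have h2 : min (M / 2 ^ k) (M / 2 ^ (k + 1)) = M / 2 ^ (k + 1) := by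
        apply min_eq_right
        gcongr
        · norm_num
        · omega
      rw [dyadicFlow, h1, hcle _ _ hk, hcle _ _ hk, h2]
      split_ifs
      · rfl
      · rw [pow_succ]; field_simp; norm_num
  · intro k j hj
    refine (hbd k j hj).2.trans ?_
    rcases le_or_gt k n with h | h
    · rw [hcle k j h]
      gcongr
      have : 0 ≤ δ * k := by positivity
      linarith
    · rw [hcgt k j h]
      calc δ * dyadicCap Fr (N - k) k j ≤ δ * ((k : ℝ) / 2 ^ k) := by
            gcongr; exact dyadicCap_le _ _ _ _
        _ = (δ * k) / 2 ^ k := by ring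
        _ ≤ _ := by gcongr; linarith
  · intro j hj hf
    have h1 := hbd N j hj
    rw [hcgt N j (by simp [N]; omega), Nat.sub_self, dyadicCap, if_neg hf, mul_zero] at h1
    exact le_antisymm h1.2 h1.1

/-- The half-open dyadic interval `[j / 2 ^ k, (j + 1) / 2 ^ k)`. -/
def dyadicIco (k j : ℕ) : Set ℝ := Set.Ico ((j : ℝ) / 2 ^ k) ((j + 1 : ℝ) / 2 ^ k)

lemma dyadicIco_split (k j : ℕ) :
    dyadicIco k j = dyadicIco (k + 1) (2 * j) ∪ dyadicIco (k + 1) (2 * j + 1) := by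
  have h1 : ((2 * j : ℕ) : ℝ) / 2 ^ (k + 1) = (j : ℝ) / 2 ^ k := by
    rw [pow_succ]; push_cast; field_simp
  have h2 : (((2 * j + 1 : ℕ) : ℝ) + 1) / 2 ^ (k + 1) = (j + 1 : ℝ) / 2 ^ k := by
    rw [pow_succ]; push_cast; field_simp; ring
  have h3 : ((2 * j : ℕ) + 1 : ℝ) / 2 ^ (k + 1) = ((2 * j + 1 : ℕ) : ℝ) / 2 ^ (k + 1) := by
    push_cast; ring
  rw [dyadicIco, dyadicIco, dyadicIco, h1, h2, h3, Ico_union_Ico_eq_Ico]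
  · rw [← h1]; gcongr; omega
  · rw [← h2]; gcongr; linarith

lemma volume_dyadicIco (k j : ℕ) : volume (dyadicIco k j) = ENNReal.ofReal (1 / 2 ^ k) := by
  rw [dyadicIco, Real.volume_Ico]
  congr 1
  ring

/-- The points of the node `(k, j)` whose first ancestor below `(k, j)` satisfying `Sat` has
level `k + d`. -/
def firstSat (Sat : ℕ → ℕ → Prop) : ℕ → ℕ → ℕ → Set ℝ
  | 0, k, j => open Classical in if Sat k j then dyadicIco k j else ∅
  | d + 1, k, j => open Classical in if Sat k j then ∅ else
      firstSat Sat d (k + 1) (2 * j) ∪ firstSat Sat d (k + 1) (2 * j + 1)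

lemma measurableSet_firstSat (Sat : ℕ → ℕ → Prop) (d k j : ℕ) :
    MeasurableSet (firstSat Sat d k j) := by
  induction d generalizing k j with
  | zero =>
    rw [firstSat]
    split_ifs
    · exact measurableSet_Ico
    · exact MeasurableSet.empty
  | succ d ih =>
    rw [firstSat]
    split_ifs
    · exact MeasurableSet.empty
    · exact (ih _ _).union (ih _ _)

lemma firstSat_subset (Sat : ℕ → ℕ → Prop) (d k j : ℕ) :
    firstSat Sat d k j ⊆ dyadicIco k j := by
  induction d generalizing k j with
  | zero =>
    rw [firstSat]
    split_ifs
    · exact Subset.rfl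
    · exact empty_subset _
  | succ d ih =>
    rw [firstSat]
    split_ifs
    · exact empty_subset _
    · rw [dyadicIco_split]
      exact union_subset_union (ih _ _) (ih _ _)

lemma exists_dyadicIco_subset_firstSat {Sat : ℕ → ℕ → Prop} {d k j : ℕ} {x : ℝ}
    (hx : x ∈ firstSat Sat d k j) :
    ∃ i, x ∈ dyadicIco (k + d) i ∧ dyadicIco (k + d) i ⊆ firstSat Sat d k j := by
  induction d generalizing k j with
  | zero =>
    rw [firstSat] at hx ⊢
    split_ifs at hx ⊢ with h
    · exact ⟨j, hx, Subset.rfl⟩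
    · exact hx.elim
  | succ d ih =>
    rw [firstSat] at hx ⊢
    split_ifs at hx ⊢ with h
    · exact hx.elim
    · rw [show k + (d + 1) = k + 1 + d by ring]
      rcases hx with hx | hx
      · obtain ⟨i, hi, hs⟩ := ih hx
        exact ⟨i, hi, hs.trans subset_union_left⟩
      · obtain ⟨i, hi, hs⟩ := ih hx
        exact ⟨i, hi, hs.trans subset_union_right⟩

lemma floor_mul_two_pow_of_mem {k j : ℕ} {x : ℝ} (hx : x ∈ dyadicIco k j) :
    ⌊x * 2 ^ k⌋₊ = j := by
  have h2 : (0 : ℝ) < 2 ^ k := by positivity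
  have h0 : 0 ≤ x := le_trans (by positivity) hx.1
  rw [Nat.floor_eq_iff (by positivity)]
  exact ⟨(div_le_iff₀ h2).1 hx.1, (lt_div_iff₀ h2).1 hx.2⟩

lemma exists_mem_firstSat {Sat : ℕ → ℕ → Prop} {D k j : ℕ} {x : ℝ} (hx : x ∈ dyadicIco k j)
    (hs : Sat (k + D) ⌊x * 2 ^ (k + D)⌋₊) : ∃ d, x ∈ firstSat Sat d k j := by
  induction D generalizing k j with
  | zero =>
    rw [Nat.add_zero, floor_mul_two_pow_of_mem hx] at hs
    exact ⟨0, by rwa [firstSat, if_pos hs]⟩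
  | succ D ih =>
    by_cases h : Sat k j
    · exact ⟨0, by rwa [firstSat, if_pos h]⟩
    · rw [show k + (D + 1) = k + 1 + D by ring] at hs
      rw [dyadicIco_split] at hx
      rcases hx with hx | hx
      · obtain ⟨d, hd⟩ := ih hx hs
        exact ⟨d + 1, by rw [firstSat, if_neg h]; exact Or.inl hd⟩
      · obtain ⟨d, hd⟩ := ih hx hs
        exact ⟨d + 1, by rw [firstSat, if_neg h]; exact Or.inr hd⟩

lemma sum_level_mul_volume_firstSat_le {Fr : ℕ → ℕ → Prop} (hFr : Hereditary Fr) (D k j : ℕ) :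
    ∑ d ∈ Finset.range D, ((k + d : ℕ) : ENNReal) *
      volume (firstSat (fun k j => dyadicCapLim Fr k j = (k : ℝ) / 2 ^ k) d k j)
      ≤ ENNReal.ofReal (dyadicCapLim Fr k j) := by
  set Sat : ℕ → ℕ → Prop := fun k j => dyadicCapLim Fr k j = (k : ℝ) / 2 ^ k with hSat
  have hnn : ∀ k j, 0 ≤ dyadicCapLim Fr k j := fun k j =>
    Real.iSup_nonneg fun d => dyadicCap_nonneg Fr d k j
  induction D generalizing k j with
  | zero => simp
  | succ D ih =>
    rw [Finset.sum_range_succ']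
    by_cases h : Sat k j
    · have h1 : ∀ d, firstSat Sat (d + 1) k j = ∅ := fun d => by rw [firstSat, if_pos h]
      have h0 : firstSat Sat 0 k j = dyadicIco k j := by rw [firstSat, if_pos h]
      simp only [h1, h0, measure_empty, mul_zero, Finset.sum_const_zero, zero_add, Nat.add_zero]
      have h' : dyadicCapLim Fr k j = (k : ℝ) / 2 ^ k := h
      rw [volume_dyadicIco, h', ← ENNReal.ofReal_natCast, ← ENNReal.ofReal_mul (by positivity)]
      apply le_of_eq
      congr 1
      ring
    · have h1 : ∀ d, firstSat Sat (d + 1) k j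
          = firstSat Sat d (k + 1) (2 * j) ∪ firstSat Sat d (k + 1) (2 * j + 1) :=
        fun d => by rw [firstSat, if_neg h]
      have h0 : firstSat Sat 0 k j = ∅ := by rw [firstSat, if_neg h]
      have hlim : dyadicCapLim Fr k j
          = dyadicCapLim Fr (k + 1) (2 * j) + dyadicCapLim Fr (k + 1) (2 * j + 1) := by
        have := dyadicCapLim_eq hFr k j
        rcases min_choice ((k : ℝ) / 2 ^ k)
          (dyadicCapLim Fr (k + 1) (2 * j) + dyadicCapLim Fr (k + 1) (2 * j + 1)) with h2 | h2
        · exact absurd (this.trans h2) h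
        · exact this.trans h2
      rw [h0, measure_empty, mul_zero, add_zero, hlim, ENNReal.ofReal_add (hnn _ _) (hnn _ _)]
      refine le_trans ?_ (add_le_add (ih (k + 1) (2 * j)) (ih (k + 1) (2 * j + 1)))
      rw [← Finset.sum_add_distrib]
      refine Finset.sum_le_sum fun d _ => ?_
      rw [h1, ← mul_add, show k + (d + 1) = k + 1 + d by ring]
      gcongr
      exact measure_union_le _ _

/-- The parametrisation `t ↦ exp (2 π i t)` of the unit circle. -/
def circlePt (t : ℝ) : ℂ := Complex.exp (((2 * Real.pi * t : ℝ) : ℂ) * Complex.I)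

lemma continuous_circlePt : Continuous circlePt := by
  unfold circlePt
  fun_prop

lemma norm_circlePt (t : ℝ) : ‖circlePt t‖ = 1 := Complex.norm_exp_ofReal_mul_I _

lemma circlePt_eq_iff {s t : ℝ} : circlePt s = circlePt t ↔ ∃ n : ℤ, s = t + n := by
  rw [circlePt, circlePt, Complex.exp_eq_exp_iff_exists_int]
  have hpi : (Real.pi : ℂ) ≠ 0 := Complex.ofReal_ne_zero.2 Real.pi_ne_zero
  refine exists_congr fun n => ?_
  constructor
  · intro h
    have h2 : ((s : ℂ)) = ((t + n : ℝ) : ℂ) := by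
      have h3 : (2 * Real.pi * Complex.I) * (s : ℂ) = (2 * Real.pi * Complex.I) * ((t + n : ℝ) : ℂ) := by
        push_cast at h ⊢
        linear_combination h
      exact mul_left_cancel₀ (by simp [hpi]) h3
    exact_mod_cast h2
  · rintro rfl
    push_cast
    ring

lemma injOn_circlePt (α : ℝ) : InjOn circlePt (Ico α (α + 1)) := by
  intro s hs t ht h
  obtain ⟨n, rfl⟩ := circlePt_eq_iff.1 h
  have h1 : (n : ℝ) < 1 := by linarith [hs.2, ht.1]
  have h2 : (-1 : ℝ) < n := by linarith [hs.1, ht.2]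
  have h3 : n < 1 := by exact_mod_cast h1
  have h4 : -1 < n := by exact_mod_cast h2
  obtain rfl : n = 0 := by omega
  simp

lemma exists_circlePt_eq (α : ℝ) {ζ : ℂ} (hζ : ζ ∈ sphere (0 : ℂ) 1) :
    ∃ t ∈ Ico α (α + 1), circlePt t = ζ := by
  have h1 : ‖ζ‖ = 1 := by simpa using hζ
  obtain ⟨θ, hθ⟩ := (Complex.norm_eq_one_iff ζ).1 h1
  obtain ⟨t, ht, n, hn⟩ : ∃ t ∈ Ico α (α + 1), ∃ n : ℤ, t = θ / (2 * Real.pi) + n := by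
    refine ⟨toIcoMod one_pos α (θ / (2 * Real.pi)), toIcoMod_mem_Ico _ _ _,
      -toIcoDiv one_pos α (θ / (2 * Real.pi)), ?_⟩
    rw [toIcoMod]
    simp
    ring
  refine ⟨t, ht, ?_⟩
  rw [circlePt_eq_iff.2 ⟨n, hn⟩, circlePt, ← hθ, mul_div_cancel₀ _ Real.two_pi_pos.ne']

lemma arcMeasure_image_circlePt {α : ℝ} {S : Set ℝ} (hS : MeasurableSet S)
    (hSα : S ⊆ Ico α (α + 1)) :
    arcMeasure (circlePt '' S) = ENNReal.ofReal (2 * Real.pi) * volume S := by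
  have h2pi := Real.two_pi_pos
  set A : Set ℝ := {θ : ℝ | Complex.exp ((θ : ℂ) * Complex.I) ∈ circlePt '' S} with hA
  have hmem : ∀ θ, θ ∈ A ↔ ∃ n : ℤ, θ / (2 * Real.pi) + n ∈ S := by
    intro θ
    have h1 : Complex.exp ((θ : ℂ) * Complex.I) = circlePt (θ / (2 * Real.pi)) := by
      rw [circlePt, mul_div_cancel₀ _ h2pi.ne']
    simp only [hA, mem_ofPred_eq, h1, mem_image, circlePt_eq_iff]
    constructor
    · rintro ⟨x, hx, n, rfl⟩
      exact ⟨n, hx⟩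
    · rintro ⟨n, hn⟩
      exact ⟨_, hn, n, rfl⟩
  have hAm : MeasurableSet A := by
    have h1 : MeasurableSet (circlePt '' S) :=
      hS.image_of_continuousOn_injOn continuous_circlePt.continuousOn
        ((injOn_circlePt α).mono hSα)
    exact (by fun_prop : Continuous fun θ : ℝ => Complex.exp ((θ : ℂ) * Complex.I)).measurable h1
  have hinv : ∀ g : AddSubgroup.zmultiples (2 * Real.pi), (fun x => g +ᵥ x) ⁻¹' A = A := by
    rintro ⟨g, n, rfl⟩
    ext θ
    simp only [mem_preimage, hmem, AddSubgroup.vadd_def, vadd_eq_add, zsmul_eq_mul]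
    have h1 : (n * (2 * Real.pi) + θ) / (2 * Real.pi) = θ / (2 * Real.pi) + n := by
      field_simp
      ring
    rw [h1]
    constructor
    · rintro ⟨m, hm⟩
      exact ⟨n + m, by push_cast; rwa [← add_assoc]⟩
    · rintro ⟨m, hm⟩
      exact ⟨m - n, by push_cast; convert hm using 1; ring⟩
  have hfd := (isAddFundamentalDomain_Ioc h2pi 0 volume).measure_set_eq
    (isAddFundamentalDomain_Ioc h2pi (2 * Real.pi * α) volume) hAm hinv
  have hico : ∀ a b : ℝ, volume (A ∩ Ioc a b) = volume (A ∩ Ico a b) := fun a b =>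
    measure_congr ((ae_eq_refl A).inter Ico_ae_eq_Ioc.symm)
  rw [hico, hico, zero_add] at hfd
  have h3 : A ∩ Ico (2 * Real.pi * α) (2 * Real.pi * α + 2 * Real.pi)
      = (fun x => (2 * Real.pi)⁻¹ * x) ⁻¹' S := by
    ext θ
    have h4 : (2 * Real.pi)⁻¹ * θ = θ / (2 * Real.pi) := by ring
    simp only [mem_inter_iff, hmem, mem_preimage, h4]
    have h5 : θ ∈ Ico (2 * Real.pi * α) (2 * Real.pi * α + 2 * Real.pi)
        ↔ θ / (2 * Real.pi) ∈ Ico α (α + 1) := by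
      rw [mem_Ico, mem_Ico, le_div_iff₀ h2pi, div_lt_iff₀ h2pi]
      constructor <;> rintro ⟨h, h'⟩ <;> constructor <;> linarith
    rw [h5]
    constructor
    · rintro ⟨⟨n, hn⟩, hθ⟩
      have h6 := injOn_circlePt α (hSα hn) hθ (circlePt_eq_iff.2 ⟨n, rfl⟩)
      rwa [h6] at hn
    · intro h
      exact ⟨⟨0, by simpa using h⟩, hSα h⟩
  have h7 : arcMeasure (circlePt '' S) = volume (A ∩ Ico 0 (2 * Real.pi)) := by
    rw [arcMeasure]
    congr 1
    ext θ
    exact and_comm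
  rw [h7, hfd, h3, Real.volume_preimage_mul_left (inv_ne_zero h2pi.ne'), inv_inv,
    abs_of_pos h2pi]

/-- An open subset of the line is the disjoint union of a sequence of (possibly empty) open
connected sets, each of which contains every preconnected subset of the open set it meets. -/
lemma exists_seq_components {U : Set ℝ} (hU : IsOpen U) :
    ∃ B : ℕ → Set ℝ, Pairwise (Function.onFun Disjoint B) ∧ ⋃ k, B k = U ∧
      (∀ k, IsOpen (B k)) ∧ (∀ k, (B k).OrdConnected) ∧
      ∀ k V, V ⊆ U → IsPreconnected V → (V ∩ B k).Nonempty → V ⊆ B k := by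
  let S : Set (Set ℝ) := (fun x => connectedComponentIn U x) '' U
  have hSo : ∀ s ∈ S, IsOpen s := by
    rintro _ ⟨x, _, rfl⟩
    exact hU.connectedComponentIn
  have hSd : S.PairwiseDisjoint id := by
    rintro _ ⟨x, hx, rfl⟩ _ ⟨y, hy, rfl⟩ hne
    refine Set.disjoint_left.2 fun z hz hz' => hne ?_
    exact (connectedComponentIn_eq hz).trans (connectedComponentIn_eq hz').symm
  have hSc : S.Countable := by
    refine hSd.countable_of_isOpen hSo ?_
    rintro _ ⟨x, hx, rfl⟩
    exact ⟨x, mem_connectedComponentIn hx⟩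
  have : Countable S := hSc
  have : Encodable S := Encodable.ofCountable S
  let B : ℕ → Set ℝ := fun k => ⋃ b ∈ Encodable.decode₂ S k, (b : Set ℝ)
  have hB : ∀ k, B k = ∅ ∨ ∃ b : S, B k = b := fun k => by
    refine Encodable.iUnion_decode₂_cases (f := fun b : S => (b : Set ℝ))
      (C := fun t => t = ∅ ∨ ∃ b : S, t = b) (Or.inl rfl) (fun b => Or.inr ⟨b, rfl⟩)
  refine ⟨B, ?_, ?_, ?_, ?_, ?_⟩
  · refine Encodable.iUnion_decode₂_disjoint_on fun a b hab => ?_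
    exact hSd a.2 b.2 fun h => hab (Subtype.ext h)
  · rw [Encodable.iUnion_decode₂]
    ext x
    simp only [mem_iUnion]
    constructor
    · rintro ⟨⟨_, y, hy, rfl⟩, hx⟩
      exact connectedComponentIn_subset U y hx
    · intro hx
      exact ⟨⟨_, x, hx, rfl⟩, mem_connectedComponentIn hx⟩
  · intro k
    rcases hB k with h | ⟨b, h⟩ <;> rw [h]
    · exact isOpen_empty
    · exact hSo _ b.2
  · intro k
    rcases hB k with h | ⟨⟨_, x, hx, rfl⟩, h⟩ <;> rw [h]
    · exact ordConnected_empty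
    · exact isPreconnected_connectedComponentIn.ordConnected
  · intro k V hV hVc hne
    rcases hB k with h | ⟨⟨_, x, hx, rfl⟩, h⟩ <;> rw [h] at hne ⊢
    · simp at hne
    · obtain ⟨y, hyV, hy⟩ := hne
      change V ⊆ connectedComponentIn U x
      rw [connectedComponentIn_eq hy]
      exact hVc.subset_connectedComponentIn hyV hV

lemma exists_eq_Ioo_of_isOpen_of_ordConnected {B : Set ℝ} (ho : IsOpen B) (hc : B.OrdConnected)
    {a b : ℝ} (hab : B ⊆ Ioo a b) (hne : B.Nonempty) :
    ∃ c d, c < d ∧ B = Ioo c d := by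
  have hbb : BddBelow B := bddBelow_Ioo.mono hab
  have hba : BddAbove B := bddAbove_Ioo.mono hab
  have hsub : Ioo (sInf B) (sSup B) ⊆ B :=
    IsConnected.Ioo_csInf_csSup_subset ⟨hne, hc.isPreconnected⟩ hbb hba
  have hB : B = Ioo (sInf B) (sSup B) := by
    refine Subset.antisymm (fun x hx => ?_) hsub
    obtain ⟨ε, hε, hball⟩ := Metric.isOpen_iff.1 ho x hx
    have h1 : x - ε / 2 ∈ B := hball (by
      rw [mem_ball, Real.dist_eq]; rw [abs_lt]; constructor <;> linarith)
    have h2 : x + ε / 2 ∈ B := hball (by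
      rw [mem_ball, Real.dist_eq]; rw [abs_lt]; constructor <;> linarith)
    exact ⟨by linarith [csInf_le hbb h1], by linarith [le_csSup hba h2]⟩
  obtain ⟨x, hx⟩ := hne
  rw [hB] at hx
  exact ⟨_, _, hx.1.trans hx.2, hB⟩

lemma isOpenArc_image_circlePt {c d : ℝ} (hcd : c < d) (hd : d ≤ c + 1) :
    IsOpenArc (circlePt '' Ioo c d) := by
  have h2pi := Real.two_pi_pos
  refine ⟨2 * Real.pi * c, 2 * Real.pi * d, by gcongr, by nlinarith, ?_⟩
  have h : Ioo (2 * Real.pi * c) (2 * Real.pi * d) = (fun t => 2 * Real.pi * t) '' Ioo c d := by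
    rw [image_mul_left_Ioo h2pi]
  rw [h, image_image]
  rfl

lemma satisfiesCarleson_image_circlePt {E : Set ℝ} {a b : ℝ} (hab : b ≤ a + 1 / 2) (hEc : IsCompact E)
    (hE : E ⊆ Icc a b) (hne : E.Nonempty) {W : ℝ → ENNReal}
    (hW : ∫⁻ x in Icc a b, W x ≠ ⊤)
    (h : ∀ᵐ x : ℝ, x ∈ Icc a b → x ∉ E → ∃ c d, x ∈ Ioo c d ∧
      Ioo c d ⊆ Icc a b ∧ Disjoint (Ioo c d) E ∧
      ENNReal.ofReal (Real.log (1 / (d - c))) ≤ W x) :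
    SatisfiesCarleson (circlePt '' E) := by
  set α := sInf E with hα
  have hαE : α ∈ E := hEc.sInf_mem hne
  have hEα : E ⊆ Ico α (α + 1) := fun x hx =>
    ⟨csInf_le hEc.bddBelow hx, by linarith [(hE hx).2, (hE hαE).1]⟩
  set U : Set ℝ := Ioo α (α + 1) \ E with hU
  have hUo : IsOpen U := isOpen_Ioo.sdiff hEc.isClosed
  obtain ⟨B, hBd, hBU, hBo, hBc, hBmax⟩ := exists_seq_components hUo
  have hBsub : ∀ k, B k ⊆ Ioo α (α + 1) := fun k =>
    ((subset_iUnion B k).trans hBU.subset).trans sdiff_subset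
  have hBsub' : ∀ k, B k ⊆ Ico α (α + 1) := fun k => (hBsub k).trans Ioo_subset_Ico_self
  have hBvol : ∀ k, volume (B k) ≤ 1 := fun k =>
    (measure_mono (hBsub k)).trans (by simp)
  have hBfin : ∀ k, volume (B k) ≠ ⊤ := fun k => ((hBvol k).trans_lt ENNReal.one_lt_top).ne
  set ℓ : ℕ → ℝ := fun k => (volume (B k)).toReal with hℓ
  have hℓ1 : ∀ k, ℓ k ≤ 1 := fun k => ENNReal.toReal_mono ENNReal.one_ne_top (hBvol k)
  have hℓ0 : ∀ k, 0 ≤ ℓ k := fun k => ENNReal.toReal_nonneg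
  have hUvol : volume U ≤ 1 := (measure_mono sdiff_subset).trans (by simp)
  have hsumvol : ∑' k, volume (B k) ≠ ⊤ := by
    rw [← measure_iUnion hBd fun k => (hBo k).measurableSet, hBU]
    exact (hUvol.trans_lt ENNReal.one_lt_top).ne
  have hsumℓ : Summable ℓ := ENNReal.summable_toReal hsumvol
  have hlen : ∀ k c d, c < d → Ioo c d ⊆ B k → d - c ≤ ℓ k := by
    intro k c d hcd hs
    have := measure_mono (μ := volume) hs
    rw [Real.volume_Ioo] at this
    exact (ENNReal.ofReal_le_iff_le_toReal (hBfin k)).1 this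
  have hlog : ∀ k c d, c < d → Ioo c d ⊆ B k → Real.log (1 / ℓ k) ≤ Real.log (1 / (d - c)) := by
    intro k c d hcd hs
    have h1 := hlen k c d hcd hs
    have h2 : 0 < d - c := sub_pos.2 hcd
    have h3 : 0 < ℓ k := h2.trans_le h1
    exact Real.log_le_log (by positivity) (by gcongr)
  set W' : ℝ → ENNReal := fun x => (Icc a b).indicator W x +
    ENNReal.ofReal (Real.log 2) with hW'
  have hkey : ∀ k, ENNReal.ofReal (ℓ k * Real.log (1 / ℓ k)) ≤ ∫⁻ x in B k, W' x := by
    intro k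
    have h1 : ENNReal.ofReal (ℓ k * Real.log (1 / ℓ k))
        = ∫⁻ _ in B k, ENNReal.ofReal (Real.log (1 / ℓ k)) := by
      rw [setLIntegral_const, ENNReal.ofReal_mul (hℓ0 k), ENNReal.ofReal_toReal (hBfin k), mul_comm]
    rw [h1]
    refine lintegral_mono_ae ?_
    rw [ae_restrict_iff' (hBo k).measurableSet]
    filter_upwards [h] with x hx hxB
    have hxU : x ∈ U := hBU ▸ mem_iUnion_of_mem k hxB
    rcases le_or_gt x b with hxa | hxa
    · have hxI : x ∈ Icc a b := ⟨(hE hαE).1.trans hxU.1.1.le, hxa⟩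
      obtain ⟨c, d, hxV, hVI, hVE, hVW⟩ := hx hxI hxU.2
      have hVU : Ioo c d ⊆ U := by
        intro y hy
        refine ⟨⟨?_, ?_⟩, fun hyE => hVE.le_bot ⟨hy, hyE⟩⟩
        · by_contra hyα
          exact hVE.le_bot ⟨⟨hy.1.trans_le (not_lt.1 hyα), hxU.1.1.trans hxV.2⟩, hαE⟩
        · linarith [(hVI hy).2, (hE hαE).1]
      have hVB := hBmax k _ hVU isPreconnected_Ioo ⟨x, hxV, hxB⟩
      calc ENNReal.ofReal (Real.log (1 / ℓ k)) ≤ ENNReal.ofReal (Real.log (1 / (d - c))) :=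
            ENNReal.ofReal_le_ofReal (hlog k c d (hxV.1.trans hxV.2) hVB)
        _ ≤ W x := hVW
        _ = (Icc a b).indicator W x := by rw [indicator_of_mem hxI]
        _ ≤ W' x := le_self_add
    · have hα1 := (hE hαE).1
      have hα2 := (hE hαE).2
      have hVU : Ioo b (α + 1) ⊆ U := fun y hy =>
        ⟨⟨hα2.trans_lt hy.1, hy.2⟩, fun hyE => absurd (hE hyE).2 (not_le.2 hy.1)⟩
      have hVB := hBmax k _ hVU isPreconnected_Ioo ⟨x, ⟨hxa, hxU.1.2⟩, hxB⟩
      have h2 := hlog k _ _ (hxa.trans hxU.1.2) hVB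
      have h3 : Real.log (1 / (α + 1 - b)) ≤ Real.log 2 := by
        have h4 : (1 / 2 : ℝ) ≤ α + 1 - b := by linarith
        refine Real.log_le_log (by positivity) ?_
        rw [div_le_iff₀ (by linarith)]
        linarith
      exact (ENNReal.ofReal_le_ofReal (h2.trans h3)).trans le_add_self
  have hsumlog : Summable fun k => ℓ k * Real.log (1 / ℓ k) := by
    have h1 : ∑' k, ENNReal.ofReal (ℓ k * Real.log (1 / ℓ k)) ≠ ⊤ := by
      refine ne_top_of_le_ne_top ?_ (ENNReal.tsum_le_tsum hkey)
      rw [← lintegral_iUnion (fun k => (hBo k).measurableSet) hBd, hBU, hW',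
        lintegral_add_right _ measurable_const, setLIntegral_const]
      refine ENNReal.add_ne_top.2 ⟨?_, ENNReal.mul_ne_top ENNReal.ofReal_ne_top
        (hUvol.trans_lt ENNReal.one_lt_top).ne⟩
      refine ne_top_of_le_ne_top hW ?_
      rw [← lintegral_indicator measurableSet_Icc]
      exact setLIntegral_le_lintegral _ _
    refine (ENNReal.summable_toReal h1).congr fun k => ?_
    refine ENNReal.toReal_ofReal (mul_nonneg (hℓ0 k) ?_)
    rcases (hℓ0 k).eq_or_lt with h0 | h0
    · simp [← h0]
    · exact Real.log_nonneg (by rw [le_div_iff₀ h0]; linarith [hℓ1 k])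
  refine ⟨fun k => circlePt '' B k, fun k => ?_, fun i j hij => ?_, ?_, ?_⟩
  · rcases (B k).eq_empty_or_nonempty with h0 | h0
    · right; simp [h0]
    · left
      obtain ⟨c, d, hcd, hB⟩ :=
        exists_eq_Ioo_of_isOpen_of_ordConnected (hBo k) (hBc k) (hBsub k) h0
      change IsOpenArc (circlePt '' B k)
      rw [hB]
      refine isOpenArc_image_circlePt hcd ?_
      linarith [hlen k c d hcd hB.ge, hℓ1 k]
  · refine Set.disjoint_left.2 ?_
    rintro _ ⟨s, hs, rfl⟩ ⟨t, ht, hst⟩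
    have := injOn_circlePt α (hBsub' j ht) (hBsub' i hs) hst
    exact Set.disjoint_left.1 (hBd hij) hs (this ▸ ht)
  · rw [← image_iUnion, hBU]
    ext ζ
    constructor
    · rintro ⟨hζ, hζE⟩
      obtain ⟨t, ht, rfl⟩ := exists_circlePt_eq α hζ
      have htE : t ∉ E := fun h => hζE ⟨t, h, rfl⟩
      refine ⟨t, ⟨⟨lt_of_le_of_ne ht.1 fun h => htE (h ▸ hαE), ht.2⟩, htE⟩, rfl⟩
    · rintro ⟨t, ht, rfl⟩
      refine ⟨by simp [norm_circlePt], ?_⟩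
      rintro ⟨s, hs, hst⟩
      have := injOn_circlePt α (hEα hs) (Ioo_subset_Ico_self ht.1) hst
      exact ht.2 (this ▸ hs)
  · have hm : ∀ k, (arcMeasure (circlePt '' B k)).toReal = 2 * Real.pi * ℓ k := fun k => by
      rw [arcMeasure_image_circlePt (hBo k).measurableSet (hBsub' k), ENNReal.toReal_mul,
        ENNReal.toReal_ofReal Real.two_pi_pos.le]
    simp only [hm]
    refine ((hsumlog.mul_left (2 * Real.pi)).sub
      (hsumℓ.mul_left (2 * Real.pi * Real.log (2 * Real.pi)))).congr fun k => ?_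
    rcases (hℓ0 k).eq_or_lt with h0 | h0
    · simp [← h0]
    · have h2pi := Real.two_pi_pos
      rw [one_div, one_div, Real.log_inv, Real.log_inv, Real.log_mul h2pi.ne' h0.ne']
      ring

/-- The closed dyadic arc of the node `(k, j)` does not meet `K`. -/
def FreeArc (K : Set ℂ) (k j : ℕ) : Prop :=
  ∀ t ∈ Icc ((j : ℝ) / 2 ^ k) ((j + 1 : ℝ) / 2 ^ k), circlePt t ∉ K

lemma hereditary_freeArc (K : Set ℂ) : Hereditary (FreeArc K) := by
  intro k j h
  refine ⟨fun t ht => h t ⟨le_trans (le_of_eq ?_) ht.1, ht.2.trans ?_⟩,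
    fun t ht => h t ⟨le_trans ?_ ht.1, ht.2.trans (le_of_eq ?_)⟩⟩
  · rw [pow_succ]; push_cast; field_simp
  · rw [pow_succ, div_le_div_iff₀ (by positivity) (by positivity)]
    have : (0 : ℝ) < 2 ^ k := by positivity
    push_cast; nlinarith
  · rw [pow_succ, div_le_div_iff₀ (by positivity) (by positivity)]
    have : (0 : ℝ) < 2 ^ k := by positivity
    push_cast; nlinarith
  · rw [pow_succ]; push_cast; field_simp; ring

/-- A point of a dyadic interval off the closed set `K` lies in a free dyadic interval of
arbitrarily high level. -/
lemma exists_freeArc {K : Set ℂ} (hK : IsClosed K) {x : ℝ} (hx0 : 0 ≤ x) (hx : circlePt x ∉ K)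
    (n : ℕ) : ∃ D, FreeArc K (n + D) ⌊x * 2 ^ (n + D)⌋₊ := by
  have ho : IsOpen (circlePt ⁻¹' Kᶜ) := hK.isOpen_compl.preimage continuous_circlePt
  obtain ⟨ε, hε, hball⟩ := Metric.isOpen_iff.1 ho x hx
  obtain ⟨D, hD⟩ := exists_pow_lt_of_lt_one hε (show (1 / 2 : ℝ) < 1 by norm_num)
  refine ⟨D, fun t ht => hball ?_⟩
  have h2 : (0 : ℝ) < 2 ^ (n + D) := by positivity
  have h3 : (1 : ℝ) / 2 ^ (n + D) < ε := by
    refine lt_of_le_of_lt ?_ hD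
    rw [div_pow, one_pow]
    gcongr
    · norm_num
    · omega
  have h4 := Nat.floor_le (show 0 ≤ x * 2 ^ (n + D) by positivity)
  have h5 := Nat.lt_floor_add_one (x * 2 ^ (n + D))
  have h6 : (⌊x * 2 ^ (n + D)⌋₊ : ℝ) / 2 ^ (n + D) ≤ x := (div_le_iff₀ h2).2 h4
  have h7 : x < ((⌊x * 2 ^ (n + D)⌋₊ : ℝ) + 1) / 2 ^ (n + D) := (lt_div_iff₀ h2).2 h5
  have h8 : ((⌊x * 2 ^ (n + D)⌋₊ : ℝ) + 1) / 2 ^ (n + D)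
      = (⌊x * 2 ^ (n + D)⌋₊ : ℝ) / 2 ^ (n + D) + 1 / 2 ^ (n + D) := by ring
  rw [mem_ball, Real.dist_eq, abs_lt]
  constructor <;> linarith [ht.1, ht.2]

/-- If `K` contains no Carleson set of positive measure then all capacities are maximal. -/
lemma dyadicCapLim_freeArc {K : Set ℂ} (hK : IsCompact K)
    (hC : ∀ E : Set ℂ, E ⊆ K → IsCompact E → arcMeasure E ≠ 0 → ¬ SatisfiesCarleson E)
    (n j : ℕ) (hn : 1 ≤ n) : dyadicCapLim (FreeArc K) n j = (n : ℝ) / 2 ^ n := by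
  by_contra hne
  have hFr := hereditary_freeArc K
  have hlt := lt_of_le_of_ne (dyadicCapLim_le (FreeArc K) n j) hne
  set Sat : ℕ → ℕ → Prop := fun k j => dyadicCapLim (FreeArc K) k j = (k : ℝ) / 2 ^ k with hSat
  set A : ℕ → Set ℝ := fun d => firstSat Sat d n j with hA
  have hsum : ∑' d, ((n + d : ℕ) : ENNReal) * volume (A d)
      ≤ ENNReal.ofReal (dyadicCapLim (FreeArc K) n j) :=
    ENNReal.tsum_le_of_sum_range_le fun D => sum_level_mul_volume_firstSat_le hFr D n j
  have hAvol : volume (⋃ d, A d) < volume (dyadicIco n j) := by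
    have h1 : (n : ENNReal) * volume (⋃ d, A d) < n * volume (dyadicIco n j) := by
      calc (n : ENNReal) * volume (⋃ d, A d) ≤ n * ∑' d, volume (A d) := by
            gcongr; exact measure_iUnion_le _
        _ = ∑' d, (n : ENNReal) * volume (A d) := ENNReal.tsum_mul_left.symm
        _ ≤ ∑' d, ((n + d : ℕ) : ENNReal) * volume (A d) := by
            refine ENNReal.tsum_le_tsum fun d => ?_
            gcongr
            omega
        _ ≤ _ := hsum
        _ < ENNReal.ofReal ((n : ℝ) / 2 ^ n) :=
            (ENNReal.ofReal_lt_ofReal_iff (by positivity)).2 hlt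
        _ = n * volume (dyadicIco n j) := by
            rw [volume_dyadicIco, ← ENNReal.ofReal_natCast, ← ENNReal.ofReal_mul (by positivity)]
            congr 1
            ring
    exact lt_of_mul_lt_mul_left' h1
  set a : ℝ := (j : ℝ) / 2 ^ n with ha
  set b : ℝ := (j + 1 : ℝ) / 2 ^ n with hb
  have ha0 : 0 ≤ a := by positivity
  have hba : b ≤ a + 1 / 2 := by
    have h1 : b = a + 1 / 2 ^ n := by rw [ha, hb]; ring
    have h2 : (1 : ℝ) / 2 ^ n ≤ 1 / 2 ^ 1 := by gcongr; norm_num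
    rw [h1]; linarith
  set E : Set ℝ := Icc a b ∩ ((circlePt ⁻¹' K) ∩ ⋂ d, (interior (A d))ᶜ) with hE
  have hEsub : E ⊆ Icc a b := inter_subset_left
  have hEc : IsCompact E := by
    refine isCompact_Icc.inter_right ?_
    exact (hK.isClosed.preimage continuous_circlePt).inter
      (isClosed_iInter fun d => isOpen_interior.isClosed_compl)
  have hdich : ∀ x ∈ dyadicIco n j, circlePt x ∉ K → ∃ d, x ∈ A d := by
    intro x hx hxK
    obtain ⟨D, hD⟩ := exists_freeArc hK.isClosed (ha0.trans hx.1) hxK n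
    exact exists_mem_firstSat hx (dyadicCapLim_of_free hFr _ _ hD)
  have hEvol : volume E ≠ 0 := by
    intro h0
    have h1 : dyadicIco n j ⊆ E ∪ ⋃ d, A d := by
      intro x hx
      by_cases h : ∃ d, x ∈ A d
      · exact Or.inr (mem_iUnion.2 h)
      · refine Or.inl ⟨Ico_subset_Icc_self hx, ?_, ?_⟩
        · by_contra hxK
          exact h (hdich x hx hxK)
        · exact mem_iInter.2 fun d hd => h ⟨d, interior_subset hd⟩
    have h2 := (measure_mono h1).trans (measure_union_le (μ := volume) _ _)
    rw [h0, zero_add] at h2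
    exact absurd h2 (not_le.2 hAvol)
  have hEne : E.Nonempty := nonempty_of_measure_ne_zero hEvol
  refine hC (circlePt '' E) ?_ (hEc.image continuous_circlePt) ?_ ?_
  · rintro _ ⟨t, ht, rfl⟩
    exact ht.2.1
  · rw [arcMeasure_image_circlePt (α := a) hEc.measurableSet
      (hEsub.trans (Icc_subset_Ico_right (by linarith)))]
    exact mul_ne_zero (ENNReal.ofReal_pos.2 Real.two_pi_pos).ne' hEvol
  set W : ℝ → ENNReal := fun x => ∑' d, (A d).indicator
    (fun _ => ENNReal.ofReal (Real.log 2) * ((n + d : ℕ) : ENNReal)) x with hW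
  refine satisfiesCarleson_image_circlePt hba hEc hEsub hEne (W := W) ?_ ?_
  · refine ne_top_of_le_ne_top ?_ (setLIntegral_le_lintegral _ _)
    rw [hW, lintegral_tsum fun d =>
      (measurable_const.indicator (measurableSet_firstSat Sat d n j)).aemeasurable]
    simp only [lintegral_indicator_const (measurableSet_firstSat Sat _ n j), mul_assoc]
    rw [ENNReal.tsum_mul_left]
    exact ENNReal.mul_ne_top ENNReal.ofReal_ne_top
      (ne_top_of_le_ne_top ENNReal.ofReal_ne_top hsum)
  · have hcount : (⋃ k : ℕ, range fun i : ℕ => (i : ℝ) / 2 ^ k).Countable :=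
      countable_iUnion fun k => countable_range _
    filter_upwards [hcount.ae_notMem volume] with x hxd hxI hxE
    have hxd' : ∀ k i : ℕ, x ≠ (i : ℝ) / 2 ^ k := fun k i h =>
      hxd (mem_iUnion.2 ⟨k, i, h.symm⟩)
    have hxIco : x ∈ dyadicIco n j := by
      refine ⟨hxI.1, lt_of_le_of_ne hxI.2 ?_⟩
      have := hxd' n (j + 1)
      push_cast at this
      exact this
    obtain ⟨d, hd⟩ : ∃ d, x ∈ A d := by
      by_cases hxK : circlePt x ∈ K
      · by_contra hno
        exact hxE ⟨hxI, hxK, mem_iInter.2 fun d hd => hno ⟨d, interior_subset hd⟩⟩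
      · exact hdich x hxIco hxK
    obtain ⟨i, hxi, hi⟩ := exists_dyadicIco_subset_firstSat hd
    have hsubA : Ioo ((i : ℝ) / 2 ^ (n + d)) ((i + 1 : ℝ) / 2 ^ (n + d)) ⊆ interior (A d) :=
      interior_maximal (Ioo_subset_Ico_self.trans hi) isOpen_Ioo
    refine ⟨(i : ℝ) / 2 ^ (n + d), (i + 1 : ℝ) / 2 ^ (n + d),
      ⟨lt_of_le_of_ne hxi.1 (hxd' _ _).symm, hxi.2⟩, ?_, ?_, ?_⟩
    · exact (hsubA.trans interior_subset).trans ((firstSat_subset Sat d n j).trans Ico_subset_Icc_self)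
    · exact Set.disjoint_left.2 fun y hy hyE => mem_iInter.1 hyE.2.2 d (hsubA hy)
    · have h1 : Real.log (1 / ((i + 1 : ℝ) / 2 ^ (n + d) - (i : ℝ) / 2 ^ (n + d)))
          = Real.log 2 * ((n + d : ℕ) : ℝ) := by
        rw [← sub_div, add_sub_cancel_left, one_div_one_div, Real.log_pow]
        ring
      rw [h1, ENNReal.ofReal_mul (Real.log_nonneg one_le_two), ENNReal.ofReal_natCast]
      refine le_trans (le_of_eq ?_) (ENNReal.le_tsum d)
      rw [indicator_of_mem hd]

lemma norm_circlePt_sub_le (s t : ℝ) :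
    ‖circlePt s - circlePt t‖ ≤ 2 * Real.pi * |s - t| := by
  have h : circlePt s - circlePt t
      = circlePt t * (Complex.exp (Complex.I * ((2 * Real.pi * (s - t) : ℝ) : ℂ)) - 1) := by
    rw [mul_sub, mul_one, circlePt, circlePt, ← Complex.exp_add]
    congr 2
    push_cast
    ring
  rw [h, norm_mul, norm_circlePt, one_mul]
  refine (Real.norm_exp_I_mul_ofReal_sub_one_le).trans ?_
  rw [Real.norm_eq_abs, abs_mul, abs_of_pos Real.two_pi_pos]

lemma circlePt_add_half (t : ℝ) : circlePt (t + 1 / 2) = -circlePt t := by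
  rw [circlePt, circlePt]
  have : (((2 * Real.pi * (t + 1 / 2) : ℝ) : ℂ) * Complex.I)
      = ((2 * Real.pi * t : ℝ) : ℂ) * Complex.I + Real.pi * Complex.I := by
    push_cast
    ring
  rw [this, Complex.exp_add, Complex.exp_pi_mul_I]
  ring

lemma circlePt_sq (t : ℝ) : circlePt t ^ 2 = circlePt (2 * t) := by
  rw [circlePt, circlePt, ← Complex.exp_nat_mul]
  congr 1
  push_cast
  ring

/-- The Herglotz kernel. -/
def herglotz (w z : ℂ) : ℂ := (w + z) / (w - z)

lemma sub_ne_zero_of_norm_lt {w z : ℂ} (h : ‖z‖ < ‖w‖) : w - z ≠ 0 := by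
  intro h0
  rw [sub_eq_zero.1 h0] at h
  exact lt_irrefl _ h

lemma herglotz_add_herglotz_neg {w z : ℂ} (h : ‖z‖ < ‖w‖) :
    herglotz w z + herglotz (-w) z = 2 * herglotz (w ^ 2) (z ^ 2) := by
  have h1 : w - z ≠ 0 := sub_ne_zero_of_norm_lt h
  have h2 : -w - z ≠ 0 := sub_ne_zero_of_norm_lt (by rwa [norm_neg])
  have h3 : w ^ 2 - z ^ 2 ≠ 0 := by
    have : w ^ 2 - z ^ 2 = -((w - z) * (-w - z)) := by ring
    rw [this]
    exact neg_ne_zero.2 (mul_ne_zero h1 h2)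
  rw [herglotz, herglotz, herglotz]
  field_simp
  ring

lemma sum_herglotz (k : ℕ) {w z : ℂ} (h : ‖z‖ < ‖w‖) :
    ∑ i ∈ Finset.range (2 ^ k), herglotz (w * circlePt ((i : ℝ) / 2 ^ k)) z
      = 2 ^ k * herglotz (w ^ 2 ^ k) (z ^ 2 ^ k) := by
  induction k generalizing w z with
  | zero => simp [circlePt]
  | succ k ih =>
    have h2 : (2 : ℕ) ^ (k + 1) = 2 ^ k + 2 ^ k := by ring
    have hsq : ‖z ^ 2‖ < ‖w ^ 2‖ := by rw [norm_pow, norm_pow]; gcongr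
    rw [h2, Finset.sum_range_add, ← Finset.sum_add_distrib]
    have h3 : ∀ i ∈ Finset.range (2 ^ k),
        herglotz (w * circlePt ((i : ℝ) / 2 ^ (k + 1))) z
          + herglotz (w * circlePt (((2 ^ k + i : ℕ) : ℝ) / 2 ^ (k + 1))) z
        = 2 * herglotz (w ^ 2 * circlePt ((i : ℝ) / 2 ^ k)) (z ^ 2) := by
      intro i _
      have h4 : ((2 ^ k + i : ℕ) : ℝ) / 2 ^ (k + 1) = (i : ℝ) / 2 ^ (k + 1) + 1 / 2 := by
        rw [pow_succ]
        push_cast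
        field_simp
        ring
      have h5 : 2 * ((i : ℝ) / 2 ^ (k + 1)) = (i : ℝ) / 2 ^ k := by
        rw [pow_succ]
        field_simp
      rw [h4, circlePt_add_half, mul_neg, herglotz_add_herglotz_neg, mul_pow, circlePt_sq, h5]
      rwa [norm_mul, norm_circlePt, mul_one]
    rw [Finset.sum_congr rfl h3, ← Finset.mul_sum, ih hsq, ← pow_mul, ← pow_mul, ← h2]
    rw [← pow_succ']
    ring

lemma herglotz_re (w z : ℂ) : (herglotz w z).re = (‖w‖ ^ 2 - ‖z‖ ^ 2) / ‖w - z‖ ^ 2 := by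
  rw [herglotz, Complex.div_re, ← Complex.normSq_eq_norm_sq, ← Complex.normSq_eq_norm_sq,
    ← Complex.normSq_eq_norm_sq, ← add_div]
  congr 1
  simp only [Complex.normSq_apply, Complex.add_re, Complex.sub_re, Complex.add_im, Complex.sub_im]
  ring

lemma norm_herglotz_sub_le {w w' z : ℂ} (hw : 1 ≤ ‖w‖) (hw' : 1 ≤ ‖w'‖) (hz : ‖z‖ < 1) :
    ‖herglotz w z - herglotz w' z‖ ≤ 2 * ‖w - w'‖ / (1 - ‖z‖) ^ 2 := by
  have h1 : w - z ≠ 0 := sub_ne_zero_of_norm_lt (by linarith)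
  have h2 : w' - z ≠ 0 := sub_ne_zero_of_norm_lt (by linarith)
  have h3 : herglotz w z - herglotz w' z = -(2 * z * (w - w')) / ((w - z) * (w' - z)) := by
    rw [herglotz, herglotz]
    field_simp
    ring
  have h4 : 1 - ‖z‖ ≤ ‖w - z‖ := by linarith [norm_sub_norm_le w z]
  have h5 : 1 - ‖z‖ ≤ ‖w' - z‖ := by linarith [norm_sub_norm_le w' z]
  have h6 : 0 < 1 - ‖z‖ := by linarith
  rw [h3, norm_div, norm_neg, norm_mul, norm_mul, norm_mul, sq, Complex.norm_two]
  have h7 : 2 * ‖z‖ * ‖w - w'‖ ≤ 2 * ‖w - w'‖ := by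
    nlinarith [norm_nonneg (w - w')]
  gcongr

lemma sum_dyadic_group {E : Type*} [AddCommGroup E] [Module ℝ E] {μ : ℕ → ℕ → ℝ}
    (hμ : ∀ k j, μ k j = μ (k + 1) (2 * j) + μ (k + 1) (2 * j + 1)) (k d : ℕ) (ψ : ℕ → E) :
    ∑ j ∈ Finset.range (2 ^ (k + d)), μ (k + d) j • ψ (j / 2 ^ d)
      = ∑ i ∈ Finset.range (2 ^ k), μ k i • ψ i := by
  have hpair : ∀ (N : ℕ) (f : ℕ → E), ∑ j ∈ Finset.range (N * 2), f j
      = ∑ i ∈ Finset.range N, (f (2 * i) + f (2 * i + 1)) := by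
    intro N f
    induction N with
    | zero => simp
    | succ N ih =>
      rw [Nat.succ_mul, Finset.sum_range_succ, Finset.sum_range_succ, ih, Finset.sum_range_succ,
        add_assoc, mul_comm N 2]
  induction d with
  | zero => simp
  | succ d ih =>
    rw [← add_assoc, pow_succ, hpair, ← ih]
    refine Finset.sum_congr rfl fun j _ => ?_
    have h1 : 2 * j / 2 ^ (d + 1) = j / 2 ^ d := by
      rw [pow_succ', Nat.mul_div_mul_left _ _ two_pos]
    have h2 : (2 * j + 1) / 2 ^ (d + 1) = j / 2 ^ d := by
      rw [pow_succ', ← Nat.div_div_eq_div_mul]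
      congr 1
      omega
    rw [h1, h2, ← add_smul, ← hμ]

lemma abs_div_two_pow_sub_ancestor_le (k d j : ℕ) :
    |(j : ℝ) / 2 ^ (k + d) - ((j / 2 ^ d : ℕ) : ℝ) / 2 ^ k| ≤ 1 / 2 ^ k := by
  have h1 : (j : ℝ) / 2 ^ (k + d) = (j : ℝ) / 2 ^ d / 2 ^ k := by
    rw [pow_add, div_div, mul_comm]
  have h2 : ((j / 2 ^ d : ℕ) : ℝ) ≤ (j : ℝ) / 2 ^ d := by
    have := Nat.cast_div_le (α := ℝ) (m := j) (n := 2 ^ d)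
    push_cast at this
    exact this
  have h3 : (j : ℝ) / 2 ^ d ≤ ((j / 2 ^ d : ℕ) : ℝ) + 1 := by
    rw [div_le_iff₀ (by positivity)]
    have := (Nat.lt_mul_div_succ j (show 0 < 2 ^ d by positivity)).le
    have h4 : (j : ℝ) ≤ ((2 ^ d * (j / 2 ^ d + 1) : ℕ) : ℝ) := by exact_mod_cast this
    push_cast at h4 ⊢
    linarith
  rw [h1, ← sub_div, abs_div, abs_of_pos (show (0 : ℝ) < 2 ^ k by positivity),
    abs_of_nonneg (by linarith)]
  gcongr
  linarith

lemma herglotz_re_nonneg {w z : ℂ} (h : ‖z‖ ≤ ‖w‖) : 0 ≤ (herglotz w z).re := by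
  rw [herglotz_re]
  have : ‖z‖ ^ 2 ≤ ‖w‖ ^ 2 := by gcongr
  exact div_nonneg (by linarith) (by positivity)

lemma herglotz_re_le {w z : ℂ} (h : ‖z‖ < ‖w‖) :
    (herglotz w z).re ≤ (‖w‖ + ‖z‖) / (‖w‖ - ‖z‖) := by
  have h1 : 0 < ‖w‖ - ‖z‖ := sub_pos.2 h
  have h2 : ‖w‖ - ‖z‖ ≤ ‖w - z‖ := norm_sub_norm_le w z
  rw [herglotz_re, show (‖w‖ + ‖z‖) / (‖w‖ - ‖z‖) = (‖w‖ ^ 2 - ‖z‖ ^ 2) / (‖w‖ - ‖z‖) ^ 2 by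
    field_simp; ring]
  have : ‖z‖ ^ 2 ≤ ‖w‖ ^ 2 := by gcongr
  gcongr

lemma herglotz_re_le_of_dist_le {w w' z : ℂ} (hw : ‖w‖ = ‖w'‖) (hz : ‖z‖ < ‖w‖)
    (h : ‖w' - w‖ ≤ 13 * ‖w - z‖) : (herglotz w z).re ≤ 196 * (herglotz w' z).re := by
  have h1 : 0 < ‖w - z‖ := norm_pos_iff.2 (sub_ne_zero_of_norm_lt hz)
  have h2 : 0 < ‖w' - z‖ := norm_pos_iff.2 (sub_ne_zero_of_norm_lt (hw ▸ hz))
  have h3 : ‖w' - z‖ ≤ 14 * ‖w - z‖ := by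
    calc ‖w' - z‖ = ‖(w' - w) + (w - z)‖ := by congr 1; ring
      _ ≤ _ := norm_add_le _ _
      _ ≤ _ := by linarith
  have h4 : ‖z‖ ^ 2 ≤ ‖w‖ ^ 2 := by gcongr
  rw [herglotz_re, herglotz_re, ← hw, ← mul_div_assoc, div_le_div_iff₀ (by positivity) (by positivity)]
  have h5 : ‖w' - z‖ ^ 2 ≤ 196 * ‖w - z‖ ^ 2 := by
    calc ‖w' - z‖ ^ 2 ≤ (14 * ‖w - z‖) ^ 2 := by gcongr
      _ = _ := by ring
  nlinarith

lemma three_mul_pow_two_pow_le {ρ R : ℝ} (hρ : 0 ≤ ρ) (hρR : ρ ≤ R) (hR : R ≤ 2) (k : ℕ)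
    (h : 1 / 2 ^ k ≤ R - ρ) : 3 * ρ ^ 2 ^ k ≤ 2 * R ^ 2 ^ k := by
  rcases hρ.eq_or_lt with rfl | hρ
  · rw [zero_pow (by positivity)]
    have := pow_nonneg hρR (2 ^ k)
    linarith
  · have h1 : ρ * (1 + 1 / 2 ^ k / ρ) ≤ R := by
      rw [mul_add, mul_div_cancel₀ _ hρ.ne']
      linarith
    have h2 := one_add_mul_le_pow (a := 1 / 2 ^ k / ρ)
      (by have : 0 ≤ 1 / 2 ^ k / ρ := by positivity
          linarith) (2 ^ k)
    have h3 : ((2 ^ k : ℕ) : ℝ) * (1 / 2 ^ k / ρ) = 1 / ρ := by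
      push_cast
      field_simp
    have h4 : 1 / 2 ≤ 1 / ρ := by
      gcongr
      linarith
    have h5 : (ρ * (1 + 1 / 2 ^ k / ρ)) ^ 2 ^ k ≤ R ^ 2 ^ k := by gcongr
    rw [mul_pow] at h5
    have h6 : 0 < ρ ^ 2 ^ k := by positivity
    nlinarith

/-- Points on the circle of radius `R` attached to the node `(k, j)`. -/
def nodePt (R : ℝ) (k j : ℕ) : ℂ := (R : ℂ) * circlePt ((j : ℝ) / 2 ^ k)

lemma norm_nodePt {R : ℝ} (hR : 0 ≤ R) (k j : ℕ) : ‖nodePt R k j‖ = R := by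
  rw [nodePt, norm_mul, norm_circlePt, mul_one, Complex.norm_real, Real.norm_eq_abs,
    abs_of_nonneg hR]

lemma norm_nodePt_sub_ancestor_le {R : ℝ} (hR0 : 0 ≤ R) (hR : R ≤ 2) (k d j : ℕ) :
    ‖nodePt R (k + d) j - nodePt R k (j / 2 ^ d)‖ ≤ 13 / 2 ^ k := by
  rw [nodePt, nodePt, ← mul_sub, norm_mul, Complex.norm_real, Real.norm_eq_abs, abs_of_nonneg hR0]
  have h1 := norm_circlePt_sub_le ((j : ℝ) / 2 ^ (k + d)) (((j / 2 ^ d : ℕ) : ℝ) / 2 ^ k)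
  have h2 := abs_div_two_pow_sub_ancestor_le k d j
  have h3 : 2 * Real.pi ≤ 6.5 := by linarith [Real.pi_lt_d2]
  calc R * ‖circlePt ((j : ℝ) / 2 ^ (k + d)) - circlePt (((j / 2 ^ d : ℕ) : ℝ) / 2 ^ k)‖
      ≤ 2 * (6.5 * (1 / 2 ^ k)) := by
        gcongr
        exact h1.trans (by gcongr)
    _ = 13 / 2 ^ k := by ring

lemma sum_dyadic_mass {μ : ℕ → ℕ → ℝ}
    (hμ : ∀ k j, μ k j = μ (k + 1) (2 * j) + μ (k + 1) (2 * j + 1)) (k : ℕ) :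
    ∑ j ∈ Finset.range (2 ^ k), μ k j = μ 0 0 := by
  have := sum_dyadic_group hμ 0 k (fun _ => (1 : ℝ))
  simpa using this

/-- Growth of the Poisson-type sum: at distance at least `2 ^ (-k)` from the circle of radius `R`
it is controlled by the largest mass density at level `k`. -/
lemma sum_mul_herglotz_re_le {μ : ℕ → ℕ → ℝ} (hμ0 : ∀ k j, j < 2 ^ k → 0 ≤ μ k j)
    (hμ : ∀ k j, μ k j = μ (k + 1) (2 * j) + μ (k + 1) (2 * j + 1)) {R : ℝ}
    (hR : R ≤ 2) {z : ℂ} (k d : ℕ) (hz : 1 / 2 ^ k ≤ R - ‖z‖) {B : ℝ} (hB0 : 0 ≤ B)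
    (hB : ∀ i < 2 ^ k, μ k i ≤ B / 2 ^ k) :
    ∑ j ∈ Finset.range (2 ^ (k + d)), μ (k + d) j * (herglotz (nodePt R (k + d) j) z).re
      ≤ 1000 * B := by
  have hk : (0 : ℝ) < 1 / 2 ^ k := by positivity
  have hzR : ‖z‖ < R := by linarith
  have hR0 : 0 ≤ R := (norm_nonneg z).trans hzR.le
  have hn : ∀ k j, ‖nodePt R k j‖ = R := norm_nodePt hR0
  have hpos : ∀ k j, 0 ≤ (herglotz (nodePt R k j) z).re := fun k j =>
    herglotz_re_nonneg (by rw [hn]; exact hzR.le)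
  have h1 : (∑ i ∈ Finset.range (2 ^ k), herglotz (nodePt R k i) z).re ≤ 2 ^ k * 5 := by
    have hzR' : ‖z‖ < ‖(R : ℂ)‖ := by
      rwa [Complex.norm_real, Real.norm_eq_abs, abs_of_nonneg hR0]
    simp only [nodePt]
    rw [sum_herglotz k hzR']
    have h2 : ((2 : ℂ) ^ k * herglotz ((R : ℂ) ^ 2 ^ k) (z ^ 2 ^ k)).re
        = 2 ^ k * (herglotz ((R : ℂ) ^ 2 ^ k) (z ^ 2 ^ k)).re := by
      rw [show ((2 : ℂ) ^ k) = ((2 ^ k : ℝ) : ℂ) by push_cast; rfl, Complex.re_ofReal_mul]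
    rw [h2]
    gcongr
    have hlt : ‖z ^ 2 ^ k‖ < ‖(R : ℂ) ^ 2 ^ k‖ := by
      rw [norm_pow, norm_pow]
      exact pow_lt_pow_left₀ hzR' (norm_nonneg z) (by positivity)
    refine (herglotz_re_le hlt).trans ?_
    rw [div_le_iff₀ (sub_pos.2 hlt)]
    have h3 := three_mul_pow_two_pow_le (norm_nonneg z) hzR.le hR k hz
    rw [norm_pow, norm_pow, Complex.norm_real, Real.norm_eq_abs, abs_of_nonneg hR0]
    linarith
  calc ∑ j ∈ Finset.range (2 ^ (k + d)), μ (k + d) j * (herglotz (nodePt R (k + d) j) z).re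
      ≤ ∑ j ∈ Finset.range (2 ^ (k + d)),
          μ (k + d) j • (196 * (herglotz (nodePt R k (j / 2 ^ d)) z).re) := by
        refine Finset.sum_le_sum fun j hj => ?_
        rw [smul_eq_mul]
        refine mul_le_mul_of_nonneg_left ?_ (hμ0 _ _ (Finset.mem_range.1 hj))
        refine herglotz_re_le_of_dist_le (by rw [hn, hn]) (by rwa [hn]) ?_
        rw [norm_sub_rev]
        refine (norm_nodePt_sub_ancestor_le hR0 hR k d j).trans ?_
        have h4 := norm_sub_norm_le (nodePt R (k + d) j) z
        rw [hn] at h4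
        calc (13 : ℝ) / 2 ^ k = 13 * (1 / 2 ^ k) := by ring
          _ ≤ _ := by gcongr; linarith
    _ = ∑ i ∈ Finset.range (2 ^ k), μ k i • (196 * (herglotz (nodePt R k i) z).re) :=
        sum_dyadic_group hμ k d fun i => 196 * (herglotz (nodePt R k i) z).re
    _ ≤ ∑ i ∈ Finset.range (2 ^ k), B / 2 ^ k * (196 * (herglotz (nodePt R k i) z).re) := by
        refine Finset.sum_le_sum fun i hi => ?_
        rw [smul_eq_mul]
        have := hpos k i
        exact mul_le_mul_of_nonneg_right (hB i (Finset.mem_range.1 hi)) (by positivity)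
    _ = B / 2 ^ k * 196 * (∑ i ∈ Finset.range (2 ^ k), herglotz (nodePt R k i) z).re := by
        rw [Complex.re_sum, Finset.mul_sum]
        refine Finset.sum_congr rfl fun i _ => by ring
    _ ≤ B / 2 ^ k * 196 * (2 ^ k * 5) := by gcongr
    _ = 980 * B := by field_simp; ring
    _ ≤ 1000 * B := by linarith

/-- If the mass is uniform at level `n` then the Herglotz sum is close to the total mass. -/
lemma norm_sum_herglotz_sub_le {μ : ℕ → ℕ → ℝ} (hμ0 : ∀ k j, j < 2 ^ k → 0 ≤ μ k j)
    (hμ : ∀ k j, μ k j = μ (k + 1) (2 * j) + μ (k + 1) (2 * j + 1)) {R M : ℝ}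
    (hR1 : 1 ≤ R) (hR : R ≤ 2) {z : ℂ} (hz : ‖z‖ < 1) (n d : ℕ)
    (hn : ∀ k j, k ≤ n → j < 2 ^ k → μ k j = M / 2 ^ k) :
    ‖∑ j ∈ Finset.range (2 ^ (n + d)), μ (n + d) j • herglotz (nodePt R (n + d) j) z - M‖
      ≤ M * (26 / (1 - ‖z‖) ^ 2 * (1 / 2) ^ n + 2 / (1 - ‖z‖) * ‖z‖ ^ 2 ^ n) := by
  have hR0 : 0 ≤ R := by linarith
  have hz1 : 0 < 1 - ‖z‖ := by linarith
  have hM : μ 0 0 = M := by simpa using hn 0 0 (Nat.zero_le n) (by simp)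
  have hM0 : 0 ≤ M := hM ▸ hμ0 0 0 (by simp)
  have hnn : ∀ k j, ‖nodePt R k j‖ = R := norm_nodePt hR0
  set S := ∑ j ∈ Finset.range (2 ^ (n + d)), μ (n + d) j • herglotz (nodePt R (n + d) j) z with hS
  set T := ∑ i ∈ Finset.range (2 ^ n), μ n i • herglotz (nodePt R n i) z with hT
  have h1 : ‖S - T‖ ≤ M * (26 / (1 - ‖z‖) ^ 2 * (1 / 2) ^ n) := by
    rw [hT, ← sum_dyadic_group hμ n d (fun i => herglotz (nodePt R n i) z), hS,
      ← Finset.sum_sub_distrib]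
    refine (norm_sum_le _ _).trans ?_
    rw [← hM, ← sum_dyadic_mass hμ (n + d), Finset.sum_mul]
    refine Finset.sum_le_sum fun j hj => ?_
    have hj0 := hμ0 _ _ (Finset.mem_range.1 hj)
    rw [← smul_sub, norm_smul, Real.norm_eq_abs, abs_of_nonneg hj0]
    refine mul_le_mul_of_nonneg_left ?_ hj0
    refine (norm_herglotz_sub_le (by rw [hnn]; exact hR1) (by rw [hnn]; exact hR1) hz).trans ?_
    have h2 := norm_nodePt_sub_ancestor_le hR0 hR n d j
    calc 2 * ‖nodePt R (n + d) j - nodePt R n (j / 2 ^ d)‖ / (1 - ‖z‖) ^ 2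
        ≤ 2 * (13 / 2 ^ n) / (1 - ‖z‖) ^ 2 := by gcongr
      _ = 26 / (1 - ‖z‖) ^ 2 * (1 / 2) ^ n := by rw [div_pow, one_pow]; ring
  have h2 : T = M * herglotz ((R : ℂ) ^ 2 ^ n) (z ^ 2 ^ n) := by
    have hzR : ‖z‖ < ‖(R : ℂ)‖ := by
      rw [Complex.norm_real, Real.norm_eq_abs, abs_of_nonneg hR0]
      linarith
    have h3 : ∀ i ∈ Finset.range (2 ^ n), μ n i • herglotz (nodePt R n i) z
        = ((M : ℂ) / 2 ^ n) * herglotz ((R : ℂ) * circlePt ((i : ℝ) / 2 ^ n)) z := by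
      intro i hi
      rw [hn n i le_rfl (Finset.mem_range.1 hi), nodePt, Complex.real_smul]
      push_cast
      rfl
    rw [hT, Finset.sum_congr rfl h3, ← Finset.mul_sum, sum_herglotz n hzR, ← mul_assoc,
      div_mul_cancel₀ _ (pow_ne_zero _ two_ne_zero)]
  have h3 : ‖T - M‖ ≤ M * (2 / (1 - ‖z‖) * ‖z‖ ^ 2 ^ n) := by
    have hpow : ‖z ^ 2 ^ n‖ ≤ ‖z‖ := by
      rw [norm_pow]
      exact pow_le_of_le_one (norm_nonneg z) hz.le (by positivity)
    have hRn : 1 ≤ ‖(R : ℂ) ^ 2 ^ n‖ := by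
      rw [norm_pow, Complex.norm_real, Real.norm_eq_abs, abs_of_nonneg hR0]
      exact one_le_pow₀ hR1
    have h4 : (R : ℂ) ^ 2 ^ n - z ^ 2 ^ n ≠ 0 := sub_ne_zero_of_norm_lt (by linarith)
    have h5 : T - M = M * (2 * z ^ 2 ^ n / ((R : ℂ) ^ 2 ^ n - z ^ 2 ^ n)) := by
      rw [h2, herglotz]
      field_simp
      ring
    have h6 : 1 - ‖z‖ ≤ ‖(R : ℂ) ^ 2 ^ n - z ^ 2 ^ n‖ := by
      linarith [norm_sub_norm_le ((R : ℂ) ^ 2 ^ n) (z ^ 2 ^ n)]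
    rw [h5, norm_mul, Complex.norm_real, Real.norm_eq_abs, abs_of_nonneg hM0, norm_div, norm_mul,
      Complex.norm_two, norm_pow, div_mul_eq_mul_div]
    gcongr
  calc ‖S - M‖ = ‖(S - T) + (T - M)‖ := by congr 1; ring
    _ ≤ _ := norm_add_le _ _
    _ ≤ _ := by linarith

lemma mass_eq_zero_of_ancestor {μ : ℕ → ℕ → ℝ} (hμ0 : ∀ k j, j < 2 ^ k → 0 ≤ μ k j)
    (hμ : ∀ k j, μ k j = μ (k + 1) (2 * j) + μ (k + 1) (2 * j + 1)) (k d : ℕ) :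
    ∀ j < 2 ^ (k + d), μ k (j / 2 ^ d) = 0 → μ (k + d) j = 0 := by
  induction d with
  | zero => simp
  | succ d ih =>
    intro j hj h
    rw [pow_succ', ← Nat.div_div_eq_div_mul] at h
    have hj' : j < 2 * 2 ^ (k + d) := by rwa [← add_assoc, pow_succ'] at hj
    have h1 := ih (j / 2) (by omega) h
    rw [hμ] at h1
    have hlt : ∀ i, i ≤ 1 → 0 ≤ μ (k + d + 1) (2 * (j / 2) + i) := fun i hi =>
      hμ0 _ _ (by rw [pow_succ']; omega)
    have h2 := hlt 0 (by simp)
    have h3 := hlt 1 le_rfl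
    rw [add_zero] at h2
    rw [← add_assoc]
    rcases Nat.even_or_odd' j with ⟨i, rfl | rfl⟩
    · rw [show 2 * i / 2 = i by omega] at h1 h2 h3
      linarith
    · rw [show (2 * i + 1) / 2 = i by omega] at h1 h2 h3
      linarith

/-- The closed free arcs of a given level stay at a positive distance from `K`. -/
lemma exists_pos_le_norm_sub_of_freeArc {K : Set ℂ} (hK : IsClosed K) (N : ℕ) :
    ∃ η > 0, ∀ i < 2 ^ N, FreeArc K N i →
      ∀ t ∈ Icc ((i : ℝ) / 2 ^ N) ((i + 1 : ℝ) / 2 ^ N), ∀ ζ ∈ K, η ≤ ‖circlePt t - ζ‖ := by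
  set Ω : Set ℂ := ⋃ i ∈ {i : ℕ | i < 2 ^ N ∧ FreeArc K N i},
    circlePt '' Icc ((i : ℝ) / 2 ^ N) ((i + 1 : ℝ) / 2 ^ N) with hΩ
  have hfin : {i : ℕ | i < 2 ^ N ∧ FreeArc K N i}.Finite :=
    (Set.finite_lt_nat (2 ^ N)).subset fun i hi => hi.1
  have hc : IsCompact Ω := hfin.isCompact_biUnion fun i _ =>
    isCompact_Icc.image continuous_circlePt
  have hd : Disjoint Ω K := by
    rw [Set.disjoint_left]
    intro x hx
    simp only [hΩ, mem_iUnion] at hx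
    obtain ⟨i, hi, t, ht, rfl⟩ := hx
    exact hi.2 t ht
  obtain ⟨η, hη, hdis⟩ := hd.exists_thickenings hc hK
  refine ⟨η, hη, fun i hi hfree t ht ζ hζ => ?_⟩
  by_contra! hlt
  refine Set.disjoint_left.1 hdis (Metric.mem_thickening_iff.2 ⟨circlePt t, ?_, ?_⟩)
    (Metric.self_subset_thickening hη K hζ)
  · exact mem_biUnion (show i ∈ {i : ℕ | i < 2 ^ N ∧ FreeArc K N i} from ⟨hi, hfree⟩)
      (mem_image_of_mem _ ht)
  · rwa [dist_comm, dist_eq_norm]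

lemma exists_two_pow_le {m : ℕ} {r : ℝ} (hr : 1 / 2 ^ m ≤ r) :
    ∃ k ≤ m, 1 / 2 ^ k ≤ r ∧ (k = 0 ∨ 2 ^ k * r < 2) := by
  classical
  have hex : ∃ k : ℕ, (1 : ℝ) / 2 ^ k ≤ r := ⟨m, hr⟩
  refine ⟨Nat.find hex, Nat.find_min' hex hr, Nat.find_spec hex, ?_⟩
  rcases h : Nat.find hex with _ | k
  · exact Or.inl rfl
  · right
    have h1 := Nat.find_min hex (m := k) (by omega)
    rw [not_le, lt_div_iff₀ (by positivity)] at h1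
    rw [pow_succ]
    linarith

lemma exists_holomorphic_of_dyadicCapLim {K : Set ℂ} (hK : IsClosed K) (hKT : K ⊆ sphere 0 1)
    (hsat : ∀ k j, 1 ≤ k → dyadicCapLim (FreeArc K) k j = (k : ℝ) / 2 ^ k)
    {M δ : ℝ} (hM : 0 < M) (hδ : 0 < δ) {n : ℕ} (hn : M < δ * n) :
    ∃ R > 1, ∃ F : ℂ → ℂ, DifferentiableOn ℂ F (ball 0 R) ∧ F 0 = 0 ∧
      (∀ ζ ∈ K, (F ζ).re ≤ 1 - M) ∧
      (∀ z ∈ ball (0 : ℂ) 1, ∃ k : ℕ, (2 : ℝ) ^ k ≤ 2 / (1 - ‖z‖) ∧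
        (F z).re ≤ 1000 * (M + δ * k)) ∧
      ∀ z ∈ ball (0 : ℂ) 1,
        ‖F z‖ ≤ M * (26 / (1 - ‖z‖) ^ 2 * (1 / 2) ^ n + 2 / (1 - ‖z‖) * ‖z‖ ^ 2 ^ n) := by
  obtain ⟨N, μ, hμ0, hμ, hun, hub, hsupp⟩ :=
    exists_dyadic_mass (hereditary_freeArc K) hsat hM hδ hn
  obtain ⟨η, hη, hdist⟩ := exists_pos_le_norm_sub_of_freeArc hK N
  obtain ⟨D, hD⟩ := exists_pow_lt_of_lt_one (show 0 < min (η / 2) (η ^ 2 / (12 * M)) by positivity)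
    (show (1 / 2 : ℝ) < 1 by norm_num)
  set m := n + N + D with hm
  set h : ℝ := 1 / 2 ^ m with hh
  have hh0 : 0 < h := by positivity
  have hhD : h ≤ (1 / 2) ^ D := by
    rw [hh, ← one_div_pow]
    exact pow_le_pow_of_le_one (by norm_num) (by norm_num) (by omega)
  have hh1 : h ≤ 1 := hhD.trans (pow_le_one₀ (by norm_num) (by norm_num))
  have hh2 : h ≤ η / 2 := hhD.trans (hD.le.trans (min_le_left _ _))
  have hh3 : h ≤ η ^ 2 / (12 * M) := hhD.trans (hD.le.trans (min_le_right _ _))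
  set R : ℝ := 1 + h with hR
  have hnn : ∀ k j, ‖nodePt R k j‖ = R := norm_nodePt (by linarith)
  have hsum : ∑ j ∈ Finset.range (2 ^ m), μ m j = M := by
    rw [sum_dyadic_mass hμ]
    simpa using hun 0 0 (Nat.zero_le n) (by simp)
  have hre : ∀ z, (∑ j ∈ Finset.range (2 ^ m), μ m j • herglotz (nodePt R m j) z - (M : ℂ)).re
      = ∑ j ∈ Finset.range (2 ^ m), μ m j * (herglotz (nodePt R m j) z).re - M := by
    intro z
    simp [Complex.sub_re, Complex.re_sum]
  refine ⟨R, by linarith, fun z => ∑ j ∈ Finset.range (2 ^ m), μ m j • herglotz (nodePt R m j) z - M,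
    ?_, ?_, ?_, ?_, ?_⟩
  · refine DifferentiableOn.sub_const (DifferentiableOn.fun_sum fun j _ => ?_) _
    refine DifferentiableOn.const_smul (c := μ m j) ?_
    unfold herglotz
    refine DifferentiableOn.div (by fun_prop) (by fun_prop) fun z hz => ?_
    refine sub_ne_zero_of_norm_lt ?_
    rw [hnn]
    simpa using hz
  · have h1 : ∀ j, herglotz (nodePt R m j) 0 = 1 := by
      intro j
      have : nodePt R m j ≠ 0 := norm_pos_iff.1 (by rw [hnn]; linarith)
      simp [herglotz, this]
    simp only [h1, ← Finset.sum_smul, hsum]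
    simp
  · intro ζ hζ
    have hζ1 : ‖ζ‖ = 1 := by simpa using hKT hζ
    rw [hre]
    have h1 : ∀ j ∈ Finset.range (2 ^ m), μ m j * (herglotz (nodePt R m j) ζ).re
        ≤ μ m j * (1 / M) := by
      intro j hj
      rw [Finset.mem_range] at hj
      by_cases hj0 : μ m j = 0
      · simp [hj0]
      refine mul_le_mul_of_nonneg_left ?_ (hμ0 _ _ hj)
      set d := n + D with hd
      have hmd : m = N + d := by omega
      set i := j / 2 ^ d with hi
      have hiN : i < 2 ^ N := by
        rw [hi, Nat.div_lt_iff_lt_mul (by positivity), ← pow_add, ← hmd]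
        exact hj
      have hfree : FreeArc K N i := by
        by_contra hf
        refine hj0 ?_
        rw [hmd] at hj ⊢
        exact mass_eq_zero_of_ancestor hμ0 hμ N d j hj (hsupp i hiN hf)
      have ht : (j : ℝ) / 2 ^ m ∈ Icc ((i : ℝ) / 2 ^ N) ((i + 1 : ℝ) / 2 ^ N) := by
        rw [hmd, pow_add, ← div_div, div_right_comm]
        have h2 : ((i : ℕ) : ℝ) ≤ (j : ℝ) / 2 ^ d := by
          have := Nat.cast_div_le (α := ℝ) (m := j) (n := 2 ^ d)
          push_cast at this
          exact this
        have h3 : (j : ℝ) / 2 ^ d ≤ i + 1 := by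
          rw [div_le_iff₀ (by positivity)]
          have := Nat.lt_div_mul_add (a := j) (b := 2 ^ d) (by positivity)
          rw [← hi] at this
          have h4 : (j : ℝ) < i * 2 ^ d + 2 ^ d := by exact_mod_cast this
          linarith
        constructor <;> gcongr
      have h2 := hdist i hiN hfree _ ht ζ hζ
      have h3 : ‖circlePt ((j : ℝ) / 2 ^ m) - nodePt R m j‖ = h := by
        have : circlePt ((j : ℝ) / 2 ^ m) - nodePt R m j = -((h : ℂ) * circlePt ((j : ℝ) / 2 ^ m)) := by
          rw [nodePt, hR]
          push_cast
          ring
        rw [this, norm_neg, norm_mul, norm_circlePt, Complex.norm_real, Real.norm_eq_abs,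
          abs_of_pos hh0, mul_one]
      have h4 : η / 2 ≤ ‖nodePt R m j - ζ‖ := by
        have := norm_sub_le_norm_sub_add_norm_sub (circlePt ((j : ℝ) / 2 ^ m)) (nodePt R m j) ζ
        linarith
      rw [herglotz_re, hnn, hζ1]
      calc (R ^ 2 - 1 ^ 2) / ‖nodePt R m j - ζ‖ ^ 2 ≤ (3 * h) / (η / 2) ^ 2 := by
            gcongr
            rw [hR]
            nlinarith
        _ = 12 / η ^ 2 * h := by field_simp; ring
        _ ≤ 12 / η ^ 2 * (η ^ 2 / (12 * M)) := by gcongr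
        _ = 1 / M := by field_simp
    have h2 := Finset.sum_le_sum h1
    rw [← Finset.sum_mul, hsum, mul_one_div_cancel hM.ne'] at h2
    linarith
  · intro z hz
    have hz1 : ‖z‖ < 1 := by simpa using hz
    have hz2 : 0 < 1 - ‖z‖ := by linarith
    obtain ⟨k, hkm, hk, hk2⟩ := exists_two_pow_le (m := m) (r := R - ‖z‖) (by linarith)
    refine ⟨k, ?_, ?_⟩
    · rw [le_div_iff₀ hz2]
      rcases hk2 with rfl | hk2
      · have := norm_nonneg z
        rw [pow_zero]
        linarith
      · refine le_trans ?_ hk2.le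
        gcongr
        linarith
    · rw [hre]
      have hsum2 := sum_mul_herglotz_re_le hμ0 hμ (by linarith) k (m - k) hk
        (B := M + δ * k) (by positivity) (hub k)
      rw [Nat.add_sub_cancel' hkm] at hsum2
      linarith
  · intro z hz
    have := norm_sum_herglotz_sub_le hμ0 hμ (R := R) (by linarith) (by linarith)
      (by simpa using hz) n (N + D) hun
    rwa [← add_assoc] at this

lemma integrableOn_one_sub_norm_rpow {a : ℝ} (ha : -1 < a) :
    IntegrableOn (fun z : ℂ => (1 - ‖z‖) ^ a) (ball 0 1) := by
  have h1 : IntervalIntegrable (fun y : ℝ => y * (1 - y) ^ a) volume 0 1 := by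
    have := (intervalIntegral.intervalIntegrable_rpow' (a := 1) (b := 0) ha).comp_sub_left 1
    norm_num at this
    exact this.continuousOn_mul continuousOn_id
  have h2 : Integrable fun z : ℂ => (Iio (1 : ℝ)).indicator (fun y => (1 - y) ^ a) ‖z‖ := by
    rw [integrable_fun_norm_addHaar (μ := (volume : Measure ℂ))
      (f := (Iio (1 : ℝ)).indicator fun y => (1 - y) ^ a)]
    have h3 : (fun y : ℝ => y ^ (Module.finrank ℝ ℂ - 1) •
        (Iio (1 : ℝ)).indicator (fun y => (1 - y) ^ a) y)
        = (Iio (1 : ℝ)).indicator fun y => y * (1 - y) ^ a := by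
      ext y
      by_cases hy : y ∈ Iio (1 : ℝ) <;> simp [hy, Complex.finrank_real_complex]
    rw [h3, IntegrableOn, integrable_indicator_iff measurableSet_Iio, IntegrableOn,
      Measure.restrict_restrict measurableSet_Iio, Iio_inter_Ioi]
    exact (intervalIntegrable_iff_integrableOn_Ioo_of_le zero_le_one).1 h1
  have h3 : (fun z : ℂ => (Iio (1 : ℝ)).indicator (fun y => (1 - y) ^ a) ‖z‖)
      = (ball (0 : ℂ) 1).indicator fun z => (1 - ‖z‖) ^ a := by
    ext z
    by_cases hz : ‖z‖ < 1 <;> simp [hz]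
  rwa [h3, integrable_indicator_iff measurableSet_ball] at h2

lemma tendsto_majorant {M x : ℝ} (hx0 : 0 ≤ x) (hx : x < 1) :
    Tendsto (fun n : ℕ => M * (26 / (1 - x) ^ 2 * (1 / 2) ^ n + 2 / (1 - x) * x ^ 2 ^ n))
      atTop (𝓝 0) := by
  have h1 : Tendsto (fun n : ℕ => (1 / 2 : ℝ) ^ n) atTop (𝓝 0) :=
    tendsto_pow_atTop_nhds_zero_of_lt_one (by norm_num) (by norm_num)
  have h2 : Tendsto (fun n : ℕ => x ^ 2 ^ n) atTop (𝓝 0) :=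
    (tendsto_pow_atTop_nhds_zero_of_lt_one hx0 hx).comp
      (tendsto_pow_atTop_atTop_of_one_lt one_lt_two)
  simpa using ((h1.const_mul (26 / (1 - x) ^ 2)).add (h2.const_mul (2 / (1 - x)))).const_mul M

lemma exp_growth_le {M p x : ℝ} (hp : 0 < p) (hx : x < 1) {k : ℕ} {w : ℂ}
    (hk : (2 : ℝ) ^ k ≤ 2 / (1 - x))
    (hw : w.re ≤ 1000 * (M + Real.log 2 / (2 * p) / 1000 * k)) :
    ‖Complex.exp w - 1‖ ^ p
      ≤ (Real.exp (1000 * M) + 1) ^ p * 2 ^ (1 / 2 : ℝ) * (1 - x) ^ (-(1 / 2) : ℝ) := by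
  have hx1 : 0 < 1 - x := by linarith
  set b := 2 / (1 - x) with hb
  have hb1 : 1 ≤ b := (one_le_pow₀ one_le_two).trans hk
  have h1 : Real.exp w.re ≤ Real.exp (1000 * M) * b ^ (1 / (2 * p)) := by
    calc Real.exp w.re ≤ Real.exp (1000 * M + k * Real.log 2 * (1 / (2 * p))) := by
          gcongr
          refine hw.trans (le_of_eq ?_)
          field_simp
      _ = Real.exp (1000 * M) * ((2 : ℝ) ^ k) ^ (1 / (2 * p)) := by
          rw [Real.exp_add, Real.exp_mul (k * Real.log 2), Real.exp_nat_mul, Real.exp_log two_pos]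
      _ ≤ _ := by gcongr
  have h2 : 1 ≤ b ^ (1 / (2 * p)) := Real.one_le_rpow hb1 (by positivity)
  have h3 : ‖Complex.exp w - 1‖ ≤ (Real.exp (1000 * M) + 1) * b ^ (1 / (2 * p)) := by
    refine (norm_sub_le _ _).trans ?_
    rw [Complex.norm_exp, norm_one]
    linarith
  calc ‖Complex.exp w - 1‖ ^ p ≤ ((Real.exp (1000 * M) + 1) * b ^ (1 / (2 * p))) ^ p := by gcongr
    _ = (Real.exp (1000 * M) + 1) ^ p * b ^ (1 / 2 : ℝ) := by
        rw [Real.mul_rpow (by positivity) (by positivity), ← Real.rpow_mul (by positivity)]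
        congr 2
        field_simp
    _ = _ := by
        rw [hb, Real.div_rpow (by norm_num) hx1.le, Real.rpow_neg hx1.le]
        ring

lemma exists_holomorphic_small_on {K : Set ℂ} (hK : IsClosed K) (hKT : K ⊆ sphere 0 1)
    (hsat : ∀ k j, 1 ≤ k → dyadicCapLim (FreeArc K) k j = (k : ℝ) / 2 ^ k)
    {p : ℝ} (hp : 0 < p) {η : ℝ} (hη : 0 < η) :
    ∃ R > 1, ∃ f : ℂ → ℂ, DifferentiableOn ℂ f (ball 0 R) ∧ f 0 = 1 ∧
      (∀ ζ ∈ K, ‖f ζ‖ < η) ∧ ∫ z in ball (0 : ℂ) 1, ‖f z - 1‖ ^ p < η := by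
  obtain ⟨M, hM, hMη⟩ : ∃ M > 0, Real.exp (1 - M) < η := by
    refine ⟨max 1 (2 - Real.log η), by positivity, ?_⟩
    rw [← Real.lt_log_iff_exp_lt hη]
    linarith [le_max_right 1 (2 - Real.log η)]
  have hlog : 0 < Real.log 2 := Real.log_pos one_lt_two
  set δ := Real.log 2 / (2 * p) / 1000 with hδ
  have hδ0 : 0 < δ := by positivity
  obtain ⟨n₀, hn₀⟩ := exists_nat_gt (M / δ)
  rw [div_lt_iff₀' hδ0] at hn₀
  have hn : ∀ n : ℕ, M < δ * (n + n₀ : ℕ) := fun n =>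
    hn₀.trans_le (by gcongr; exact Nat.le_add_left _ _)
  choose R hR F hF hF0 hFK hFgr hFlim using fun n : ℕ =>
    exists_holomorphic_of_dyadicCapLim hK hKT hsat hM hδ0 (hn n)
  have hsub : ∀ n, ball (0 : ℂ) 1 ⊆ ball 0 (R n) := fun n => ball_subset_ball (hR n).le
  have hlim : Tendsto (fun n => ∫ z in ball (0 : ℂ) 1, ‖Complex.exp (F n z) - 1‖ ^ p) atTop
      (𝓝 (∫ _ in ball (0 : ℂ) 1, (0 : ℝ))) := by
    refine tendsto_integral_of_dominated_convergence
      (fun z => (Real.exp (1000 * M) + 1) ^ p * 2 ^ (1 / 2 : ℝ) * (1 - ‖z‖) ^ (-(1 / 2) : ℝ))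
      (fun n => ?_) ((integrableOn_one_sub_norm_rpow (by norm_num)).const_mul _) (fun n => ?_) ?_
    · refine ContinuousOn.aestronglyMeasurable (fun z hz => ?_) measurableSet_ball
      have h1 := (((hF n).mono (hsub n)).cexp.sub_const 1).continuousOn.norm z hz
      exact h1.rpow_const (Or.inr hp.le)
    · refine (ae_restrict_mem measurableSet_ball).mono fun z hz => ?_
      obtain ⟨k, hk, hk2⟩ := hFgr n z hz
      rw [Real.norm_of_nonneg (by positivity)]
      exact exp_growth_le hp (by simpa using hz) hk hk2
    · refine (ae_restrict_mem measurableSet_ball).mono fun z hz => ?_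
      have hz1 : ‖z‖ < 1 := by simpa using hz
      have h1 : Tendsto (fun n => F n z) atTop (𝓝 0) :=
        squeeze_zero_norm (fun n => hFlim n z hz)
          ((tendsto_majorant (norm_nonneg z) hz1).comp (tendsto_add_atTop_nat n₀))
      have h2 := ((Complex.continuous_exp.tendsto 0).comp h1).sub_const 1
      rw [Complex.exp_zero, sub_self] at h2
      have h3 := h2.norm.rpow_const (p := p) (Or.inr hp.le)
      rwa [norm_zero, Real.zero_rpow hp.ne'] at h3
  rw [integral_zero] at hlim
  obtain ⟨n, hn⟩ := (hlim.eventually_lt_const hη).exists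
  refine ⟨R n, hR n, fun z => Complex.exp (F n z), (hF n).cexp, by simp [hF0], fun ζ hζ => ?_, hn⟩
  rw [Complex.norm_exp]
  exact (Real.exp_le_exp.2 (hFK n ζ hζ)).trans_lt hMη

/-- Area measure on the unit disc. -/
abbrev diskMeasure : Measure ℂ := volume.restrict (ball (0 : ℂ) 1)

instance : IsFiniteMeasure diskMeasure :=
  isFiniteMeasure_restrict.2 measure_ball_lt_top.ne

lemma map_smul_diskMeasure_le {r : ℝ} (hr : 1 / 2 ≤ r) (hr1 : r ≤ 1) :
    diskMeasure.map (r • ·) ≤ (4 : ENNReal) • diskMeasure := by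
  have hr0 : 0 < r := by linarith
  refine Measure.le_iff.2 fun A hA => ?_
  have hT : Measurable fun z : ℂ => r • z := measurable_const_smul r
  rw [Measure.map_apply hT hA, Measure.restrict_apply (hT hA), Measure.smul_apply,
    Measure.restrict_apply hA, smul_eq_mul]
  have hsub : (r • ·) ⁻¹' A ∩ ball (0 : ℂ) 1 ⊆ (r • ·) ⁻¹' (A ∩ ball (0 : ℂ) 1) := by
    intro z hz
    refine ⟨hz.1, ?_⟩
    have h1 : ‖z‖ < 1 := by simpa using hz.2
    have h2 : ‖r • z‖ ≤ 1 * ‖z‖ := by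
      rw [norm_smul, Real.norm_of_nonneg hr0.le]
      gcongr
    rw [mem_ball_zero_iff]
    linarith
  refine (measure_mono hsub).trans ?_
  rw [Measure.addHaar_preimage_smul _ hr0.ne', Complex.finrank_real_complex]
  gcongr
  rw [abs_of_pos (by positivity), show (4 : ENNReal) = ENNReal.ofReal 4 by norm_num]
  refine ENNReal.ofReal_le_ofReal ?_
  rw [inv_le_comm₀ (by positivity) (by norm_num)]
  nlinarith

lemma unifIntegrable_dilation {p : ENNReal} (hp1 : 1 ≤ p) (hp : p ≠ ⊤) {g : ℂ → ℂ}
    (hg : MemLp g p diskMeasure) {r : ℕ → ℝ} (hr : ∀ n, 1 / 2 ≤ r n) (hr1 : ∀ n, r n ≤ 1) :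
    UnifIntegrable (fun n z => g (r n • z)) p diskMeasure := by
  intro ε hε
  obtain ⟨δ, hδ, h⟩ := hg.eLpNorm_indicator_le hp1 hp (show 0 < ε / 4 by positivity)
  refine ⟨δ, hδ, fun n s hs hsδ => ?_⟩
  have hr0 : 0 < r n := by linarith [hr n]
  set s' := s ∩ ball (0 : ℂ) 1 with hs'
  have hs'm : MeasurableSet s' := hs.inter measurableSet_ball
  have hT : MeasurableEmbedding fun z : ℂ => r n • z :=
    (Homeomorph.smulOfNeZero (r n) hr0.ne').measurableEmbedding
  set A := (r n • ·) '' s' with hA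
  have hAm : MeasurableSet A := hT.measurableSet_image.2 hs'm
  have hAδ : diskMeasure A ≤ ENNReal.ofReal δ := by
    refine le_trans ?_ hsδ
    rw [Measure.restrict_apply hs]
    refine (Measure.restrict_apply_le _ _).trans ?_
    rw [show volume A = _ from Measure.addHaar_smul volume (r n) s', Complex.finrank_real_complex]
    refine mul_le_of_le_one_left (zero_le) ?_
    rw [ENNReal.ofReal_le_one, abs_of_pos (by positivity)]
    exact pow_le_one₀ hr0.le (hr1 n)
  have hae : s.indicator (fun z => g (r n • z)) =ᵐ[diskMeasure]
      A.indicator g ∘ fun z => r n • z := by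
    filter_upwards [ae_restrict_mem measurableSet_ball] with z hz
    have : z ∈ s ↔ r n • z ∈ A := by
      rw [hA, hT.injective.mem_set_image]
      exact ⟨fun h => ⟨h, hz⟩, fun h => h.1⟩
    by_cases hzs : z ∈ s
    · rw [indicator_of_mem hzs, Function.comp, indicator_of_mem (this.1 hzs)]
    · rw [indicator_of_notMem hzs, Function.comp, indicator_of_notMem (mt this.2 hzs)]
  have hle := map_smul_diskMeasure_le (hr n) (hr1 n)
  have hac : diskMeasure.map (r n • ·) ≪ diskMeasure :=
    (Measure.absolutelyContinuous_of_le hle).trans Measure.smul_absolutelyContinuous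
  rw [eLpNorm_congr_ae hae, ← eLpNorm_map_measure
    ((hg.1.indicator hAm).mono_ac hac) hT.measurable.aemeasurable]
  refine (eLpNorm_mono_measure _ hle).trans ?_
  rw [eLpNorm_smul_measure_of_ne_top hp, smul_eq_mul]
  calc (4 : ENNReal) ^ (1 / p).toReal * eLpNorm (A.indicator g) p diskMeasure
      ≤ 4 ^ (1 : ℝ) * ENNReal.ofReal (ε / 4) := by
        gcongr
        · norm_num
        · refine ENNReal.toReal_le_of_le_ofReal zero_le_one ?_
          simpa using hp1
        · exact h A hAm hAδ
    _ = ENNReal.ofReal ε := by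
        rw [ENNReal.rpow_one, show (4 : ENNReal) = ENNReal.ofReal 4 by norm_num,
          ← ENNReal.ofReal_mul (by norm_num)]
        congr 1
        ring

lemma exists_polynomial_norm_sub_le {R : ℝ} (hR : 1 < R) {f : ℂ → ℂ}
    (hf : DifferentiableOn ℂ f (ball 0 R)) {η : ℝ} (hη : 0 < η) :
    ∃ P : ℂ[X], ∀ z ∈ closedBall (0 : ℂ) 1, ‖P.eval z - f z‖ < η := by
  lift R to NNReal using by linarith
  have hR' : (1 : NNReal) < R := by exact_mod_cast hR
  obtain ⟨a, ha1, haR⟩ := exists_between hR'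
  obtain ⟨b, hb1, hba⟩ := exists_between ha1
  have h1 : DifferentiableOn ℂ f (closedBall 0 a) :=
    hf.mono (closedBall_subset_ball (by exact_mod_cast haR))
  have h2 := (h1.hasFPowerSeriesOnBall (zero_lt_one.trans ha1)).tendstoUniformlyOn
    (r' := b) (by exact_mod_cast hba)
  obtain ⟨n, hn⟩ := ((Metric.tendstoUniformlyOn_iff.1 h2) η hη).exists
  refine ⟨∑ k ∈ Finset.range n, C ((cauchyPowerSeries f 0 a).coeff k) * X ^ k, fun z hz => ?_⟩
  have h3 := hn z (closedBall_subset_ball (by exact_mod_cast hb1) hz)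
  rw [zero_add, dist_eq_norm, norm_sub_rev] at h3
  have h4 : (∑ k ∈ Finset.range n, C ((cauchyPowerSeries f 0 a).coeff k) * X ^ k).eval z
      = (cauchyPowerSeries f 0 a).partialSum n z := by
    rw [FormalMultilinearSeries.partialSum, eval_finsetSum]
    refine Finset.sum_congr rfl fun k _ => ?_
    rw [FormalMultilinearSeries.apply_eq_pow_smul_coeff, eval_mul, eval_C, eval_pow, eval_X,
      smul_eq_mul, mul_comm]
  rwa [h4]

lemma eLpNorm_diskMeasure_le {p : ENNReal} (hp1 : 1 ≤ p) {f : ℂ → ℂ} {c : ℝ}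
    (hf : ∀ z ∈ ball (0 : ℂ) 1, ‖f z‖ ≤ c) :
    eLpNorm f p diskMeasure ≤ ENNReal.ofReal (4 * c) := by
  refine (eLpNorm_le_of_ae_bound ((ae_restrict_mem measurableSet_ball).mono hf)).trans ?_
  rw [ENNReal.ofReal_mul (by norm_num), Measure.restrict_apply_univ, Complex.volume_ball]
  gcongr
  have h4 : (1 : ENNReal) ≤ ENNReal.ofReal 4 := by norm_num
  calc (ENNReal.ofReal 1 ^ 2 * (NNReal.pi : ENNReal)) ^ p.toReal⁻¹
      ≤ ENNReal.ofReal 4 ^ p.toReal⁻¹ := by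
        gcongr
        rw [ENNReal.ofReal_one, one_pow, one_mul, ENNReal.le_ofReal_iff_toReal_le (by simp) (by simp)]
        simpa using Real.pi_le_four
    _ ≤ ENNReal.ofReal 4 ^ (1 : ℝ) := by
        gcongr
        rcases eq_or_ne p ⊤ with rfl | hp
        · simp
        · exact inv_le_one_of_one_le₀ (by simpa using ENNReal.toReal_mono hp hp1)
    _ = _ := ENNReal.rpow_one _

lemma memLp_eval (P : ℂ[X]) (p : ENNReal) : MemLp (fun z => P.eval z) p diskMeasure := by
  obtain ⟨c, hc⟩ := (isCompact_closedBall (0 : ℂ) 1).exists_bound_of_continuousOn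
    P.continuous.continuousOn
  exact MemLp.of_bound P.continuous.aestronglyMeasurable c
    ((ae_restrict_mem measurableSet_ball).mono fun z hz => hc z (ball_subset_closedBall hz))

/-- Polynomials are dense in the Bergman space. -/
lemma exists_polynomial_eLpNorm_sub_le {p : ENNReal} (hp1 : 1 ≤ p) (hp : p ≠ ⊤) {g : ℂ → ℂ}
    (hg : DifferentiableOn ℂ g (ball 0 1)) (hgp : MemLp g p diskMeasure) {η : ℝ} (hη : 0 < η) :
    ∃ P : ℂ[X], eLpNorm (fun z => P.eval z - g z) p diskMeasure ≤ ENNReal.ofReal η := by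
  set r : ℕ → ℝ := fun n => 1 - 1 / (n + 2) with hr
  have hr1 : ∀ n, r n < 1 := fun n => by
    have : (0 : ℝ) < 1 / (n + 2) := by positivity
    simp only [hr]; linarith
  have hr2 : ∀ n, 1 / 2 ≤ r n := fun n => by
    have : (1 : ℝ) / (n + 2) ≤ 1 / 2 := by gcongr; linarith [n.cast_nonneg (α := ℝ)]
    simp only [hr]; linarith
  have hrlim : Tendsto r atTop (𝓝 1) := by
    have h := (tendsto_one_div_add_atTop_nhds_zero_nat (𝕜 := ℝ)).comp (tendsto_add_atTop_nat 1)
    have h2 : Tendsto (fun n : ℕ => (1 : ℝ) / (n + 2)) atTop (𝓝 0) := by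
      refine h.congr fun n => ?_
      simp only [Function.comp]
      push_cast
      ring_nf
    have h3 := h2.const_sub 1
    rwa [sub_zero] at h3
  have hdiff : ∀ n, DifferentiableOn ℂ (fun z => g (r n • z)) (ball 0 (r n)⁻¹) := fun n => by
    have hr0 : 0 < r n := by linarith [hr2 n]
    refine hg.comp ((differentiable_id.const_smul (r n)).differentiableOn) fun z hz => ?_
    rw [mem_ball_zero_iff] at hz ⊢
    rw [norm_smul, Real.norm_of_nonneg hr0.le]
    calc r n * ‖z‖ < r n * (r n)⁻¹ := by gcongr
      _ = 1 := mul_inv_cancel₀ hr0.ne'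
  have hinv : ∀ n, 1 < (r n)⁻¹ := fun n =>
    (one_lt_inv₀ (by linarith [hr2 n])).2 (hr1 n)
  have hmeas : ∀ n, AEStronglyMeasurable (fun z => g (r n • z)) diskMeasure := fun n =>
    ((hdiff n).continuousOn.mono (ball_subset_ball (hinv n).le)).aestronglyMeasurable
      measurableSet_ball
  have hlim := tendsto_Lp_finite_of_tendsto_ae hp1 hp hmeas hgp
    (unifIntegrable_dilation hp1 hp hgp hr2 fun n => (hr1 n).le) (by
      filter_upwards [ae_restrict_mem measurableSet_ball] with z hz
      have h1 : Tendsto (fun n => r n • z) atTop (𝓝 z) := by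
        simpa using hrlim.smul_const z
      exact ((hg.continuousOn.continuousAt (isOpen_ball.mem_nhds hz)).tendsto).comp h1)
  obtain ⟨n, hn⟩ := (hlim.eventually_le_const
    (show 0 < ENNReal.ofReal (η / 2) by simpa using half_pos hη)).exists
  obtain ⟨P, hP⟩ := exists_polynomial_norm_sub_le (hinv n) (hdiff n) (show 0 < η / 8 by positivity)
  refine ⟨P, ?_⟩
  have hsplit : (fun z => P.eval z - g z)
      = (fun z => P.eval z - g (r n • z)) + ((fun z => g (r n • z)) - g) := by
    ext z
    simp
  rw [hsplit]
  refine (eLpNorm_add_le (P.continuous.aestronglyMeasurable.sub (hmeas n))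
    ((hmeas n).sub hgp.1) hp1).trans ?_
  calc _ ≤ ENNReal.ofReal (4 * (η / 8)) + ENNReal.ofReal (η / 2) := by
        gcongr
        exact eLpNorm_diskMeasure_le hp1 fun z hz => (hP z (ball_subset_closedBall hz)).le
    _ = ENNReal.ofReal η := by
        rw [← ENNReal.ofReal_add (by positivity) (by positivity)]
        congr 1
        ring

/-- Polynomials that are small on `K`, close to `1` in the Bergman norm and close to `1` at `0`. -/
lemma exists_polynomial_small_on {K : Set ℂ} (hK : IsCompact K) (hKT : K ⊆ sphere 0 1)
    (hadm : BergmanAdmissible K) {p : ℝ} (hp : 1 ≤ p) {η : ℝ} (hη : 0 < η) :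
    ∃ P : ℂ[X], ‖P.eval 0 - 1‖ < η ∧ (∀ ζ ∈ K, ‖P.eval ζ‖ < η) ∧
      eLpNorm (fun z => 1 - P.eval z) (ENNReal.ofReal p) diskMeasure ≤ ENNReal.ofReal η := by
  have hp0 : 0 < p := by linarith
  have hp1 : 1 ≤ ENNReal.ofReal p := ENNReal.one_le_ofReal.2 hp
  have hC : ∀ E : Set ℂ, E ⊆ K → IsCompact E → arcMeasure E ≠ 0 → ¬ SatisfiesCarleson E := by
    rcases hadm with h | h
    · exact h.2
    · refine fun E hEK _ hE => absurd ?_ hE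
      have hmono : arcMeasure E ≤ arcMeasure K := measure_mono fun θ hθ => ⟨hθ.1, hEK hθ.2⟩
      exact le_antisymm (hmono.trans h.le) zero_le
  obtain ⟨R, hR, f, hf, hf0, hfK, hfp⟩ := exists_holomorphic_small_on hK.isClosed hKT
    (fun k j hk => dyadicCapLim_freeArc hK hC k j hk) hp0
    (show 0 < min (η / 2) ((η / 2) ^ p) by positivity)
  obtain ⟨P, hP⟩ := exists_polynomial_norm_sub_le hR hf (show 0 < η / 8 by positivity)
  refine ⟨P, ?_, fun ζ hζ => ?_, ?_⟩
  · rw [← hf0]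
    exact (hP 0 (by simp)).trans (by linarith)
  · have h1 := hP ζ (sphere_subset_closedBall (hKT hζ))
    have h2 := (hfK ζ hζ).trans_le (min_le_left _ _)
    have h3 := norm_le_norm_sub_add (P.eval ζ) (f ζ)
    linarith
  · have hfm : AEStronglyMeasurable (fun z => f z - 1) diskMeasure :=
      ((hf.continuousOn.mono (ball_subset_ball hR.le)).sub continuousOn_const).aestronglyMeasurable
        measurableSet_ball
    have hfb : MemLp (fun z => f z - 1) (ENNReal.ofReal p) diskMeasure := by
      obtain ⟨c, hc⟩ := (isCompact_closedBall (0 : ℂ) 1).exists_bound_of_continuousOn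
        ((hf.continuousOn.mono (closedBall_subset_ball hR)).sub continuousOn_const)
      exact MemLp.of_bound hfm c
        ((ae_restrict_mem measurableSet_ball).mono fun z hz => hc z (ball_subset_closedBall hz))
    have hf1 : eLpNorm (fun z => f z - 1) (ENNReal.ofReal p) diskMeasure
        ≤ ENNReal.ofReal (η / 2) := by
      rw [← ofReal_lpNorm hfb, lpNorm_eq_integral_norm_rpow_toReal (by simpa using hp0)
        ENNReal.ofReal_ne_top hfm, ENNReal.toReal_ofReal hp0.le]
      refine ENNReal.ofReal_le_ofReal ?_
      rw [Real.rpow_inv_le_iff_of_pos (integral_nonneg fun _ => by positivity)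
        (by positivity) hp0]
      exact (hfp.trans_le (min_le_right _ _)).le
    have hsplit : (fun z => 1 - P.eval z) = (fun z => f z - P.eval z) - fun z => f z - 1 := by
      ext z
      simp
    rw [hsplit]
    refine (eLpNorm_sub_le ?_ hfm hp1).trans ?_
    · exact (hf.continuousOn.mono (ball_subset_ball hR.le)).aestronglyMeasurable
        measurableSet_ball |>.sub P.continuous.aestronglyMeasurable
    · calc _ ≤ ENNReal.ofReal (4 * (η / 8)) + ENNReal.ofReal (η / 2) := by
            gcongr
            refine eLpNorm_diskMeasure_le hp1 fun z hz => ?_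
            rw [norm_sub_rev]
            exact (hP z (ball_subset_closedBall hz)).le
        _ = ENNReal.ofReal η := by
            rw [← ENNReal.ofReal_add (by positivity) (by positivity)]
            congr 1
            ring

/-- If some polynomials are small on `K` and close to `1` at the origin, then polynomials are
dense in the continuous functions on `K`. -/
lemma exists_polynomial_norm_sub_lt_on {K : Set ℂ} (hK : IsCompact K) (hKT : K ⊆ sphere 0 1)
    (h : ∀ η > 0, ∃ P : ℂ[X], ‖P.eval 0 - 1‖ < η ∧ ∀ ζ ∈ K, ‖P.eval ζ‖ < η)
    {φ : ℂ → ℂ} (hφ : ContinuousOn φ K) {ε : ℝ} (hε : 0 < ε) :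
    ∃ P : ℂ[X], ∀ ζ ∈ K, ‖P.eval ζ - φ ζ‖ < ε := by
  have : CompactSpace K := isCompact_iff_compactSpace.1 hK
  set A := (polynomialFunctions K).topologicalClosure with hA
  set x := toContinuousMapOnAlgHom K (X : ℂ[X]) with hx
  have hxA : x ∈ A := Subalgebra.le_topologicalClosure _ ⟨X, trivial, rfl⟩
  have hsA : star x ∈ A := by
    rw [hA, ← SetLike.mem_coe, Subalgebra.topologicalClosure_coe, Metric.mem_closure_iff]
    intro η hη
    obtain ⟨P, hP0, hPK⟩ := h (min (1 / 2) (η / 4)) (by positivity)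
    set c := P.coeff 0 with hc
    rw [← coeff_zero_eq_eval_zero, ← hc] at hP0
    have hc1 : 1 / 2 < ‖c‖ := by
      have h1 := norm_sub_norm_le 1 c
      rw [norm_one, norm_sub_rev] at h1
      linarith [min_le_left (1 / 2) (η / 4)]
    have hc0 : c ≠ 0 := norm_pos_iff.1 (by linarith)
    refine ⟨toContinuousMapOnAlgHom K (-(P.divX * C c⁻¹)), ⟨_, trivial, rfl⟩, ?_⟩
    refine lt_of_le_of_lt ((ContinuousMap.dist_le (half_pos hη).le).2 fun ζ => ?_) (half_lt_self hη)
    have hζ : ‖(ζ : ℂ)‖ = 1 := by simpa using hKT ζ.2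
    have h1 : (P.divX.eval (ζ : ℂ)) * ζ + c = P.eval (ζ : ℂ) := by
      conv_rhs => rw [← divX_mul_X_add P]
      simp [hc]
    have h2 : (starRingEnd ℂ) (ζ : ℂ) * ζ = 1 := by
      rw [mul_comm, Complex.mul_conj, Complex.normSq_eq_norm_sq, hζ]
      simp
    have h3 : ((starRingEnd ℂ) (ζ : ℂ) + P.divX.eval (ζ : ℂ) * c⁻¹) * ζ = P.eval (ζ : ℂ) / c := by
      rw [← h1, add_mul, h2]
      field_simp
      ring
    have h4 : dist (star x ζ) (toContinuousMapOnAlgHom K (-(P.divX * C c⁻¹)) ζ)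
        = ‖P.eval (ζ : ℂ)‖ / ‖c‖ := by
      rw [← norm_div, ← h3, norm_mul, hζ, mul_one, dist_eq_norm]
      simp [hx]
    rw [h4, div_le_iff₀ (by linarith)]
    have := (hPK ζ ζ.2).trans_le (min_le_right _ _)
    nlinarith
  have htop : A = ⊤ := by
    have h1 : ((polynomialFunctions K).starClosure).toSubalgebra ≤ A := by
      rw [polynomialFunctions.starClosure_eq_adjoin_X, StarAlgebra.adjoin_toSubalgebra]
      refine Algebra.adjoin_le ?_
      rintro y (rfl | hy)
      · exact hxA
      · rw [Set.mem_star, mem_singleton_iff] at hy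
        rw [← star_star y, hy]
        exact hsA
    have h2 := polynomialFunctions.starClosure_topologicalClosure (𝕜 := ℂ) K
    refine eq_top_iff.2 fun y _ => ?_
    have h3 : y ∈ (polynomialFunctions K).starClosure.topologicalClosure := h2 ▸ trivial
    rw [← SetLike.mem_coe, StarSubalgebra.topologicalClosure_coe] at h3
    exact closure_minimal h1 (Subalgebra.isClosed_topologicalClosure _) h3
  set ψ : C(K, ℂ) := ⟨K.domRestrict φ, hφ.domRestrict⟩ with hψ
  have hmem : ψ ∈ A := htop ▸ trivial
  rw [hA, ← SetLike.mem_coe, Subalgebra.topologicalClosure_coe, Metric.mem_closure_iff] at hmem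
  obtain ⟨_, ⟨P, -, rfl⟩, hP⟩ := hmem ε hε
  refine ⟨P, fun ζ hζ => ?_⟩
  have := (ContinuousMap.dist_apply_le_dist (⟨ζ, hζ⟩ : K)).trans_lt hP
  rw [dist_comm, dist_eq_norm] at this
  exact this

lemma bergmanNorm_le {p : ℝ} (hp : 0 < p) {f : ℂ → ℂ}
    (hf : MemLp f (ENNReal.ofReal p) diskMeasure) :
    bergmanNorm p f ≤ lpNorm f (ENNReal.ofReal p) diskMeasure := by
  rw [bergmanNorm, lpNorm_eq_integral_norm_rpow_toReal (by simpa using hp)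
    ENNReal.ofReal_ne_top hf.1, ENNReal.toReal_ofReal hp.le, one_div]
  have h1 : 0 ≤ ∫ z in ball (0 : ℂ) 1, ‖f z‖ ^ p := integral_nonneg fun _ => by positivity
  gcongr
  refine mul_le_of_le_one_left h1 (inv_le_one_of_one_le₀ ?_)
  linarith [Real.pi_gt_three]

/-- Lemma (bergmerg): simultaneous approximation in `A^p` norm and uniformly on an admissible
compact set `K ⊆ 𝕋`. -/
theorem statement_6 (p : ℝ) (hp : 1 ≤ p)
    (K : Set ℂ) (hKc : IsCompact K) (hKT : K ⊆ Metric.sphere (0:ℂ) 1)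
    (hK : BergmanAdmissible K)
    (g : ℂ → ℂ) (hg : MemAp p g) (φ : ℂ → ℂ) (hφ : ContinuousOn φ K)
    (ε : ℝ) (hε : 0 < ε) :
    ∃ P : Polynomial ℂ,
      bergmanNorm p (fun z => P.eval z - g z) < ε ∧ ∀ ζ ∈ K, ‖P.eval ζ - φ ζ‖ < ε := by
  have hp0 : 0 < p := by linarith
  have hp1 : 1 ≤ ENNReal.ofReal p := ENNReal.one_le_ofReal.2 hp
  have hgp : MemLp g (ENNReal.ofReal p) diskMeasure := by
    refine (integrable_norm_rpow_iff (hg.1.continuousOn.aestronglyMeasurable measurableSet_ball)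
      (by simpa using hp0) ENNReal.ofReal_ne_top).1 ?_
    rw [ENNReal.toReal_ofReal hp0.le]
    exact hg.2
  obtain ⟨q, hq⟩ := exists_polynomial_eLpNorm_sub_le hp1 ENNReal.ofReal_ne_top hg.1 hgp
    (show 0 < ε / 4 by positivity)
  obtain ⟨h, hh⟩ := exists_polynomial_norm_sub_lt_on hKc hKT (fun η hη => by
    obtain ⟨P, h0, h1, -⟩ := exists_polynomial_small_on hKc hKT hK hp hη
    exact ⟨P, h0, h1⟩) hφ (half_pos hε)
  obtain ⟨B, hB⟩ := (isCompact_closedBall (0 : ℂ) 1).exists_bound_of_continuousOn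
    (h - q).continuous.continuousOn
  have hB0 : 0 ≤ B := (norm_nonneg _).trans (hB 0 (by simp))
  obtain ⟨Q, -, hQK, hQ⟩ := exists_polynomial_small_on hKc hKT hK hp
    (show 0 < ε / (4 * (B + 1)) by positivity)
  have hBε : B * (ε / (4 * (B + 1))) ≤ ε / 4 := by
    rw [← mul_div_assoc, div_le_div_iff₀ (by positivity) (by positivity)]
    nlinarith
  refine ⟨h - (h - q) * Q, ?_, fun ζ hζ => ?_⟩
  · have hmem : MemLp (fun z => (h - (h - q) * Q).eval z - g z) (ENNReal.ofReal p) diskMeasure :=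
      (memLp_eval _ _).sub hgp
    refine (bergmanNorm_le hp0 hmem).trans_lt ?_
    have hsplit : (fun z => (h - (h - q) * Q).eval z - g z)
        = (fun z => q.eval z - g z) + fun z => (h - q).eval z * (1 - Q.eval z) := by
      ext z
      simp only [eval_sub, eval_mul, Pi.add_apply]
      ring
    have hprod : eLpNorm (fun z => (h - q).eval z * (1 - Q.eval z)) (ENNReal.ofReal p) diskMeasure
        ≤ ENNReal.ofReal (ε / 4) := by
      refine (eLpNorm_le_mul_eLpNorm_of_ae_le_mul (c := B) (g := fun z => 1 - Q.eval z)
        ((ae_restrict_mem measurableSet_ball).mono fun z hz => ?_) _).trans ?_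
      · rw [norm_mul]
        gcongr
        exact hB z (ball_subset_closedBall hz)
      · refine (mul_le_mul_right hQ _).trans ?_
        rw [← ENNReal.ofReal_mul hB0]
        exact ENNReal.ofReal_le_ofReal hBε
    rw [← toReal_eLpNorm hmem.1, hsplit]
    refine lt_of_le_of_lt (ENNReal.toReal_le_of_le_ofReal (half_pos hε).le ?_) (half_lt_self hε)
    refine (eLpNorm_add_le ((memLp_eval q _).sub hgp).1
      ((h - q).continuous.mul (continuous_const.sub Q.continuous)).aestronglyMeasurable hp1).trans ?_
    refine (add_le_add hq hprod).trans (le_of_eq ?_)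
    rw [← ENNReal.ofReal_add (by positivity) (by positivity)]
    congr 1
    ring
  · have h1 : (h - (h - q) * Q).eval ζ - φ ζ = (h.eval ζ - φ ζ) - (h - q).eval ζ * Q.eval ζ := by
      simp only [eval_sub, eval_mul]
      ring
    have h2 : ‖(h - q).eval ζ * Q.eval ζ‖ ≤ ε / 4 := by
      rw [norm_mul]
      refine le_trans ?_ hBε
      gcongr
      · exact hB ζ (sphere_subset_closedBall (hKT hζ))
      · exact (hQK ζ hζ).le
    rw [h1]
    linarith [norm_sub_le (h.eval ζ - φ ζ) ((h - q).eval ζ * Q.eval ζ), hh ζ hζ]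
end
end

section
/- Let 1 ≤ p < ∞ and let K ⊆ 𝕋 be compact with m(K) = 0. Then there exists a function f ∈ H^p(𝔻) such that for every continuous function φ on K there exists an increasing sequence (r_n) in [0,1) converging to 1 with sup_{ζ∈K} |f(r_n ζ) − φ(ζ)| → 0 as n → ∞; in particular, there exist functions in H^p(𝔻) whose radial limits approximate every continuous function on K. -/
open Complex Metric Set Filter MeasureTheory Polynomial Topology

noncomputable section

theorem norm_exp_mul_I_sub_exp_mul_I_le (s t : ℝ) :
    ‖exp (s * I) - exp (t * I)‖ ≤ |s - t| := by
  have h : exp (s * I) - exp (t * I) = exp (t * I) * (exp (I * ((s - t : ℝ) : ℂ)) - 1) := by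
    rw [mul_sub, ← Complex.exp_add]
    push_cast
    ring_nf
  rw [h, norm_mul, norm_exp_ofReal_mul_I, one_mul]
  exact Real.norm_exp_I_mul_ofReal_sub_one_le

theorem exists_exp_mul_I_eq {z : ℂ} (hz : z ∈ sphere (0 : ℂ) 1) :
    ∃ θ ∈ Ico (0 : ℝ) (2 * Real.pi), exp (θ * I) = z := by
  have hz1 : ‖z‖ = 1 := by simpa using hz
  refine ⟨toIcoMod Real.two_pi_pos 0 (arg z), ?_, ?_⟩
  · simpa using toIcoMod_mem_Ico Real.two_pi_pos 0 (arg z)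
  · have h := norm_mul_exp_arg_mul_I z
    rw [hz1, ofReal_one, one_mul] at h
    conv_rhs => rw [← h]
    rw [Complex.exp_eq_exp_iff_exists_int]
    refine ⟨-toIcoDiv Real.two_pi_pos 0 (arg z), ?_⟩
    rw [toIcoMod]
    simp only [zsmul_eq_mul]
    push_cast
    ring

/-- A compact arc-null subset of the circle is covered by finitely many discs, centred on the
circle, of arbitrarily small total radius. -/
theorem exists_finset_cover_of_arcMeasure_eq_zero {K : Set ℂ} (hKc : IsCompact K)
    (hKT : K ⊆ sphere (0 : ℂ) 1) (hKm : arcMeasure K = 0) {η : ℝ} (hη : 0 < η) :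
    ∃ (t : Finset ℝ) (δ : ℝ → ℝ), (∀ x ∈ t, 0 < δ x) ∧ ∑ x ∈ t, δ x ≤ η ∧
      ∀ z ∈ K, ∃ x ∈ t, ‖z - exp (x * I)‖ ≤ δ x := by
  set E : Set ℝ := {θ : ℝ | θ ∈ Ico (0 : ℝ) (2 * Real.pi) ∧ exp (θ * I) ∈ K} with hE
  have hE0 : volume E = 0 := hKm
  obtain ⟨t, r, -, -, hr, hcov, hsum⟩ :=
    Besicovitch.exists_closedBall_covering_tsum_measure_le (volume : Measure ℝ)
      (ε := ENNReal.ofReal η) (by simpa using hη) (fun _ => Ioi 0) E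
      (fun x _ δ hδ => ⟨δ / 2, by simp; linarith, by constructor <;> linarith⟩)
  rw [hE0, zero_add] at hsum
  obtain ⟨u, hu⟩ := hKc.elim_finite_subcover
    (fun x : t => ball (exp ((x : ℝ) * I)) (2 * r x)) (fun _ => isOpen_ball) (by
      intro z hz
      obtain ⟨θ, hθ, rfl⟩ := exists_exp_mul_I_eq (hKT hz)
      obtain ⟨x, hx, hθx⟩ := mem_iUnion₂.1 (hcov (show θ ∈ E from ⟨hθ, hz⟩))
      refine mem_iUnion.2 ⟨⟨x, hx⟩, ?_⟩
      rw [mem_ball, dist_eq_norm]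
      have h1 := norm_exp_mul_I_sub_exp_mul_I_le θ x
      rw [mem_closedBall, Real.dist_eq] at hθx
      have h2 : 0 < r x := hr x hx
      linarith)
  classical
  refine ⟨u.image (fun x : t => (x : ℝ)), fun x => 2 * r x, ?_, ?_, ?_⟩
  · intro x hx
    obtain ⟨y, -, rfl⟩ := Finset.mem_image.1 hx
    have : 0 < r y := hr y y.2
    linarith
  · rw [Finset.sum_image (fun _ _ _ _ h => Subtype.ext h)]
    have h1 := (ENNReal.sum_le_tsum u).trans hsum
    simp only [Real.volume_closedBall] at h1
    rw [← ENNReal.ofReal_sum_of_nonneg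
      (f := fun x : t => 2 * r x)
      (fun x _ => mul_nonneg zero_le_two (le_of_lt (hr x x.2)))] at h1
    exact (ENNReal.ofReal_le_ofReal_iff hη.le).1 h1
  · intro z hz
    obtain ⟨x, hx, hzx⟩ := mem_iUnion₂.1 (hu hz)
    refine ⟨x, Finset.mem_image_of_mem _ hx, ?_⟩
    rw [mem_ball, dist_eq_norm] at hzx
    exact hzx.le

/-- Disc-algebra functions peaking on `K` and small on a given smaller disc. -/
theorem exists_peak {K : Set ℂ} (hKc : IsCompact K)
    (hKT : K ⊆ sphere (0 : ℂ) 1) (hKm : arcMeasure K = 0) {ε ρ : ℝ} (hε : 0 < ε) (hρ : ρ < 1) :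
    ∃ q : ℂ → ℂ, DiffContOnCl ℂ q (ball 0 1) ∧
      (∀ z ∈ closedBall (0 : ℂ) 1, ‖q z‖ ^ 2 ≤ (q z).re) ∧
      (∀ z ∈ K, ‖q z - 1‖ ≤ ε) ∧ ∀ z : ℂ, ‖z‖ ≤ ρ → ‖q z‖ ≤ ε := by
  set M : ℝ := 4 / ε with hM
  have hMpos : 0 < M := by positivity
  obtain ⟨t, δ, hδ, hsum, hcov⟩ := exists_finset_cover_of_arcMeasure_eq_zero hKc hKT hKm
    (η := ε * (1 - ρ) / M) (by have : 0 < 1 - ρ := by linarith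
                               positivity)
  set s : ℝ → ℂ → ℂ := fun x z => 1 + δ x - exp (-(x * I)) * z with hs
  have hnorm : ∀ (x : ℝ) (z : ℂ), ‖exp (-(x * I)) * z‖ = ‖z‖ := by
    intro x z
    have := norm_exp_ofReal_mul_I (-x)
    push_cast at this
    rw [norm_mul, ← neg_mul, this, one_mul]
  have hsre : ∀ x (z : ℂ), 1 - ‖z‖ + δ x ≤ (s x z).re := by
    intro x z
    have h1 := re_le_norm (exp (-(x * I)) * z)
    rw [hnorm] at h1
    simp only [hs, sub_re, add_re, one_re, ofReal_re]
    linarith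
  have hspos : ∀ x ∈ t, ∀ z ∈ closedBall (0 : ℂ) 1, 0 < (s x z).re := by
    intro x hx z hz
    have := hsre x z
    have := hδ x hx
    have : ‖z‖ ≤ 1 := by simpa using hz
    linarith
  have hs0 : ∀ x ∈ t, ∀ z ∈ closedBall (0 : ℂ) 1, s x z ≠ 0 := by
    intro x hx z hz h
    have := hspos x hx z hz
    simp [h] at this
  set F : ℂ → ℂ := fun z => ∑ x ∈ t, M * δ x / s x z with hF
  have hterm : ∀ x ∈ t, ∀ z ∈ closedBall (0 : ℂ) 1,
      (M * δ x / s x z).re = M * δ x * ((s x z).re / ‖s x z‖ ^ 2) := by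
    intro x hx z hz
    have : (M * δ x : ℂ) = ((M * δ x : ℝ) : ℂ) := by push_cast; rfl
    rw [this, div_eq_mul_inv, re_ofReal_mul, inv_re, normSq_eq_norm_sq]
  have hterm0 : ∀ x ∈ t, ∀ z ∈ closedBall (0 : ℂ) 1, 0 ≤ (M * δ x / s x z).re := by
    intro x hx z hz
    rw [hterm x hx z hz]
    have := hδ x hx
    have := hspos x hx z hz
    positivity
  have hFre : ∀ z ∈ closedBall (0 : ℂ) 1, 0 ≤ (F z).re := by
    intro z hz
    rw [hF, re_sum]
    exact Finset.sum_nonneg fun x hx => hterm0 x hx z hz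
  have hF1norm : ∀ z, 1 + (F z).re ≤ ‖1 + F z‖ := by
    intro z
    simpa using re_le_norm (1 + F z)
  have hF1 : ∀ z ∈ closedBall (0 : ℂ) 1, 1 + F z ≠ 0 := by
    intro z hz h
    have h1 := hF1norm z
    have h2 := hFre z hz
    rw [h, norm_zero] at h1
    linarith
  have hFd : DifferentiableOn ℂ F (closedBall 0 1) := by
    intro z hz
    refine DifferentiableWithinAt.fun_sum fun x hx => ?_
    refine DifferentiableWithinAt.div (by fun_prop) (by simp only [hs]; fun_prop) (hs0 x hx z hz)
  refine ⟨fun z => F z / (1 + F z), ?_, ?_, ?_, ?_⟩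
  · apply DifferentiableOn.diffContOnCl
    rw [closure_ball _ one_ne_zero]
    exact hFd.div (hFd.const_add 1) hF1
  · intro z hz
    have h2 := hFre z hz
    have h3 : 0 < ‖1 + F z‖ ^ 2 := by have := norm_pos_iff.2 (hF1 z hz); positivity
    have h4 : (F z / (1 + F z)).re = ((F z).re + ‖F z‖ ^ 2) / ‖1 + F z‖ ^ 2 := by
      rw [div_eq_mul_inv, mul_re, inv_re, inv_im, normSq_eq_norm_sq, ← normSq_eq_norm_sq (F z),
        normSq_apply]
      simp only [add_re, add_im, one_re, one_im]
      ring
    simp only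
    rw [h4, norm_div, div_pow]
    gcongr
    linarith
  · intro z hz
    have hz1 : ‖z‖ = 1 := by simpa using hKT hz
    have hzc : z ∈ closedBall (0 : ℂ) 1 := sphere_subset_closedBall (hKT hz)
    obtain ⟨x, hx, hzx⟩ := hcov z hz
    have hd := hδ x hx
    have hsn : ‖s x z‖ ≤ 2 * δ x := by
      have h1 : s x z = δ x - exp (-(x * I)) * (z - exp (x * I)) := by
        simp only [hs]
        rw [mul_sub, ← Complex.exp_add]
        simp
        ring
      rw [h1]
      refine (norm_sub_le _ _).trans ?_
      rw [hnorm, norm_real, Real.norm_of_nonneg hd.le]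
      linarith
    have h2 := hsre x z
    rw [hz1] at h2
    have hsn0 : 0 < ‖s x z‖ := norm_pos_iff.2 (hs0 x hx z hzc)
    have h3 : M / 4 ≤ (M * δ x / s x z).re := by
      rw [hterm x hx z hzc]
      have h4 : δ x / (2 * δ x) ^ 2 ≤ (s x z).re / ‖s x z‖ ^ 2 := by
        gcongr <;> linarith
      calc M / 4 = M * δ x * (δ x / (2 * δ x) ^ 2) := by field_simp; ring
        _ ≤ _ := by gcongr
    have h5 : M / 4 ≤ (F z).re := by
      rw [hF, re_sum]
      exact h3.trans (Finset.single_le_sum (f := fun x => (M * δ x / s x z).re)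
        (fun y hy => hterm0 y hy z hzc) hx)
    have h6 : F z / (1 + F z) - 1 = -(1 / (1 + F z)) := by
      have := hF1 z hzc
      field_simp
      ring
    have h7 := hF1norm z
    simp only
    rw [h6, norm_neg, norm_div, norm_one]
    have h8 : M / 4 ≤ ‖1 + F z‖ := by linarith
    calc 1 / ‖1 + F z‖ ≤ 1 / (M / 4) := by gcongr
      _ = ε := by rw [hM]; field_simp
  · intro z hz
    have hzc : z ∈ closedBall (0 : ℂ) 1 := by simp; linarith
    have h1 : 1 ≤ ‖1 + F z‖ := by linarith [hF1norm z, hFre z hzc]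
    have hρ1 : 0 < 1 - ρ := by linarith
    simp only
    rw [norm_div]
    refine (div_le_self (norm_nonneg _) h1).trans ?_
    calc ‖F z‖ ≤ ∑ x ∈ t, M * δ x / (1 - ρ) := by
          refine norm_sum_le_of_le _ fun x hx => ?_
          have hd := hδ x hx
          have h2 := hsre x z
          have h3 := re_le_norm (s x z)
          rw [norm_div, norm_mul, norm_real, norm_real, Real.norm_of_nonneg hd.le,
            Real.norm_of_nonneg hMpos.le]
          gcongr
          linarith
      _ = M * (∑ x ∈ t, δ x) / (1 - ρ) := by rw [Finset.mul_sum, Finset.sum_div]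
      _ ≤ M * (ε * (1 - ρ) / M) / (1 - ρ) := by gcongr
      _ = ε := by field_simp

/-- Laurent polynomials are dense in the continuous functions on a compact subset of the circle. -/
theorem exists_laurent_approx {K : Set ℂ} (hKc : IsCompact K) (hKT : K ⊆ sphere (0 : ℂ) 1)
    {φ : ℂ → ℂ} (hφ : ContinuousOn φ K) {ε : ℝ} (hε : 0 < ε) :
    ∃ (N : ℕ) (P : ℂ[X]), ∀ z ∈ K, ‖P.eval z / z ^ N - φ z‖ ≤ ε := by
  have : CompactSpace K := isCompact_iff_compactSpace.1 hKc
  set g : C(K, ℂ) := ⟨K.domRestrict φ, continuousOn_iff_continuous_domRestrict.1 hφ⟩ with hg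
  have hmem : g ∈ ((polynomialFunctions K).starClosure.topologicalClosure : StarSubalgebra ℂ _) := by
    rw [polynomialFunctions.starClosure_topologicalClosure]
    trivial
  obtain ⟨h, hh, hdist⟩ := Metric.mem_closure_iff.1 hmem ε hε
  have hne : ∀ z : K, (z : ℂ) ≠ 0 := fun z h0 => by
    have := hKT z.2
    simp [h0] at this
  have key : ∃ (N : ℕ) (P : ℂ[X]), ∀ z : K, h z = P.eval (z : ℂ) / (z : ℂ) ^ N := by
    rw [polynomialFunctions.starClosure_eq_adjoin_X] at hh
    replace hh : h ∈ Algebra.adjoin ℂ (_ ∪ _) := hh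
    clear hdist
    induction hh using Algebra.adjoin_induction with
    | mem x hx =>
      rcases hx with hx | hx
      · rw [mem_singleton_iff] at hx
        exact ⟨0, X, fun z => by simp [hx]⟩
      · rw [Set.star_singleton, mem_singleton_iff] at hx
        refine ⟨1, 1, fun z => ?_⟩
        have hz : ‖(z : ℂ)‖ = 1 := by simpa using hKT z.2
        have : (starRingEnd ℂ) (z : ℂ) * z = 1 := by
          rw [conj_mul', hz]; simp
        rw [hx]
        simp only [ContinuousMap.star_apply, eval_one, pow_one]
        rw [eq_div_iff (hne z)]
        simpa using this
    | algebraMap r => exact ⟨0, C r, fun z => by simp⟩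
    | add x y _ _ hx hy =>
      obtain ⟨N, P, hP⟩ := hx
      obtain ⟨L, Q, hQ⟩ := hy
      refine ⟨N + L, P * X ^ L + Q * X ^ N, fun z => ?_⟩
      have := hne z
      simp only [ContinuousMap.add_apply, hP, hQ, eval_add, eval_mul, eval_pow, eval_X]
      field_simp
      ring
    | mul x y _ _ hx hy =>
      obtain ⟨N, P, hP⟩ := hx
      obtain ⟨L, Q, hQ⟩ := hy
      refine ⟨N + L, P * Q, fun z => ?_⟩
      have := hne z
      simp only [ContinuousMap.mul_apply, hP, hQ, eval_mul]
      field_simp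
      ring
  obtain ⟨N, P, hP⟩ := key
  refine ⟨N, P, fun z hz => ?_⟩
  have h1 := (ContinuousMap.dist_lt_iff hε).1 hdist ⟨z, hz⟩
  rw [dist_comm, hP, dist_eq_norm] at h1
  exact h1.le

theorem mul_exp_mul_I_mem_ball {r : ℝ} (hr : r ∈ Ioo (0 : ℝ) 1) (θ : ℝ) :
    (r : ℂ) * exp (θ * I) ∈ ball (0 : ℂ) 1 := by
  rw [mem_ball_zero_iff, norm_mul, norm_exp_ofReal_mul_I, mul_one, norm_real,
    Real.norm_of_nonneg hr.1.le]
  exact hr.2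

theorem continuous_comp_circle {h : ℂ → ℂ} (hh : ContinuousOn h (ball 0 1)) {r : ℝ}
    (hr : r ∈ Ioo (0 : ℝ) 1) : Continuous fun θ : ℝ => h (r * exp (θ * I)) :=
  hh.comp_continuous (by fun_prop) (mul_exp_mul_I_mem_ball hr)

/-- The unnormalised `L^p` norm of `h` on the circle of radius `r`. -/
def circleLpNorm (p r : ℝ) (h : ℂ → ℂ) : ENNReal :=
  eLpNorm (fun θ : ℝ => h (r * exp (θ * I))) (ENNReal.ofReal p)
    (volume.restrict (Ioc 0 (2 * Real.pi)))

theorem circleLpNorm_eq {p : ℝ} (hp : 1 ≤ p) {h : ℂ → ℂ} (hh : ContinuousOn h (ball 0 1))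
    {r : ℝ} (hr : r ∈ Ioo (0 : ℝ) 1) :
    circleLpNorm p r h =
      ENNReal.ofReal ((∫ θ in (0 : ℝ)..(2 * Real.pi), ‖h (r * exp (θ * I))‖ ^ p) ^ (1 / p)) := by
  have hc := continuous_comp_circle hh hr
  obtain ⟨B, hB⟩ := (isCompact_Icc (a := (0 : ℝ)) (b := 2 * Real.pi)).exists_bound_of_continuousOn
    hc.continuousOn
  have hmem : MemLp (fun θ : ℝ => h (r * exp (θ * I))) (ENNReal.ofReal p)
      (volume.restrict (Ioc 0 (2 * Real.pi))) := by
    refine MemLp.of_bound hc.aestronglyMeasurable B ?_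
    filter_upwards [ae_restrict_mem measurableSet_Ioc] with θ hθ
    exact hB θ (Ioc_subset_Icc_self hθ)
  rw [circleLpNorm, hmem.eLpNorm_eq_integral_rpow_norm (by simp; linarith) ENNReal.ofReal_ne_top,
    ENNReal.toReal_ofReal (by linarith), intervalIntegral.integral_of_le Real.two_pi_pos.le,
    one_div]

/-- Mean value property for the real part. -/
theorem integral_re_circle {q : ℂ → ℂ} (hq : DiffContOnCl ℂ q (ball 0 1)) {r : ℝ}
    (hr : r ∈ Ioo (0 : ℝ) 1) :
    ∫ θ in (0 : ℝ)..(2 * Real.pi), (q (r * exp (θ * I))).re = 2 * Real.pi * (q 0).re := by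
  have hc := continuous_comp_circle (hq.continuousOn.mono subset_closure) hr
  have h1 : DiffContOnCl ℂ q (ball 0 |r|) := hq.mono (ball_subset_ball (by
    rw [abs_of_pos hr.1]; exact hr.2.le))
  have h2 := h1.circleAverage
  rw [Real.circleAverage] at h2
  simp only [circleMap, zero_add] at h2
  have h3 := ContinuousLinearMap.intervalIntegral_comp_comm reCLM
    (hc.intervalIntegrable (μ := volume) 0 (2 * Real.pi))
  simp only [reCLM_apply] at h3
  rw [h3, ← h2, real_smul, re_ofReal_mul, mul_inv_cancel_left₀ Real.two_pi_pos.ne']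

/-- Simultaneous approximation: a disc-algebra function can be close to `φ` on `K`, close to `0` on
a given smaller disc, and of small Hardy norm. -/
theorem exists_simultaneous_approx {p : ℝ} (hp : 1 ≤ p) {K : Set ℂ} (hKc : IsCompact K)
    (hKT : K ⊆ sphere (0 : ℂ) 1) (hKm : arcMeasure K = 0) {φ : ℂ → ℂ} (hφ : ContinuousOn φ K)
    {ε ρ : ℝ} (hε : 0 < ε) (hρ : ρ < 1) :
    ∃ h : ℂ → ℂ, DiffContOnCl ℂ h (ball 0 1) ∧ (∀ z ∈ K, ‖h z - φ z‖ ≤ ε) ∧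
      (∀ z : ℂ, ‖z‖ ≤ ρ → ‖h z‖ ≤ ε) ∧
      ∀ r ∈ Ioo (0 : ℝ) 1, circleLpNorm p r h ≤ ENNReal.ofReal ε := by
  obtain ⟨N, P, hP⟩ := exists_laurent_approx hKc hKT hφ (half_pos hε)
  obtain ⟨C, hC1, hC⟩ : ∃ C : ℝ, 1 ≤ C ∧ ∀ z ∈ closedBall (0 : ℂ) 1, ‖P.eval z‖ ≤ C := by
    obtain ⟨C, hC⟩ := (isCompact_closedBall (0 : ℂ) 1).exists_bound_of_continuousOn
      P.continuous.continuousOn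
    exact ⟨max C 1, le_max_right _ _, fun z hz => (hC z hz).trans (le_max_left _ _)⟩
  have hC0 : 0 < C := by linarith
  set D : ℝ := 4 * 2 ^ N * C with hD
  have hD0 : 0 < D := by positivity
  have hpi := Real.two_pi_pos
  obtain ⟨e, he, hcont⟩ : ∃ e > 0, ∀ x : ℂ, ‖x - 1‖ < e → ‖x ^ (N + 2) - 1‖ < ε / (2 * C) := by
    have h1 : ContinuousAt (fun x : ℂ => x ^ (N + 2)) 1 := by fun_prop
    obtain ⟨e, he, h2⟩ := Metric.continuousAt_iff.1 h1 (ε / (2 * C)) (by positivity)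
    refine ⟨e, he, fun x hx => ?_⟩
    simpa [dist_eq_norm] using h2 (x := x) (by simpa [dist_eq_norm] using hx)
  obtain ⟨d, hd, hd1, hde, hdD, hdp⟩ : ∃ d : ℝ, 0 < d ∧ d ≤ 1 ∧ 2 * d < e ∧ D * d ≤ ε ∧
      D ^ p * (2 * Real.pi * d) ≤ ε ^ p := by
    have hDp : 0 < D ^ p * (2 * Real.pi) := by positivity
    refine ⟨min (min 1 (e / 3)) (min (ε / D) (ε ^ p / (D ^ p * (2 * Real.pi)))), ?_, ?_, ?_, ?_, ?_⟩
    · have := Real.rpow_pos_of_pos hε p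
      have := Real.rpow_pos_of_pos hD0 p
      positivity
    · exact (min_le_left _ _).trans (min_le_left _ _)
    · have := (min_le_left (min 1 (e / 3))
        (min (ε / D) (ε ^ p / (D ^ p * (2 * Real.pi))))).trans (min_le_right _ _)
      linarith
    · rw [← le_div_iff₀' hD0]
      exact (min_le_right _ _).trans (min_le_left _ _)
    · rw [← mul_assoc, ← le_div_iff₀' hDp]
      exact (min_le_right _ _).trans (min_le_right _ _)
  obtain ⟨q, hq, hqre, hqK, hqρ⟩ := exists_peak hKc hKT hKm hd (max_lt hρ one_pos)
  have hq0 : ‖q 0‖ ≤ d := hqρ 0 (by simp)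
  have hq1 : ∀ z ∈ closedBall (0 : ℂ) 1, ‖q z‖ ≤ 1 := by
    intro z hz
    have h1 := hqre z hz
    have h2 := re_le_norm (q z)
    nlinarith [norm_nonneg (q z)]
  have hds : ∀ z ∈ ball (0 : ℂ) 1, ‖dslope q 0 z‖ ≤ 2 := by
    intro z hz
    have := norm_dslope_le_div_of_mapsTo_ball (R₂ := 2) hq.differentiableOn (fun w hw => by
      rw [mem_closedBall, dist_eq_norm]
      have := norm_sub_le (q w) (q 0)
      have := hq1 w (ball_subset_closedBall hw)
      linarith) hz
    simpa using this
  have hdsd : DiffContOnCl ℂ (dslope q 0) (ball 0 1) := by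
    have hn : ball (0 : ℂ) 1 ∈ 𝓝 0 := ball_mem_nhds _ one_pos
    exact ⟨(differentiableOn_dslope hn).2 hq.differentiableOn,
      (continuousOn_dslope (mem_of_superset hn subset_closure)).2
        ⟨hq.continuousOn, hq.differentiableOn.differentiableAt hn⟩⟩
  set h : ℂ → ℂ := fun z => dslope q 0 z ^ N * (q z - q 0) ^ 2 * P.eval z with hh
  have hhd : DiffContOnCl ℂ h (ball 0 1) := by
    refine ⟨?_, ?_⟩
    · exact ((hdsd.differentiableOn.pow N).mul ((hq.differentiableOn.sub_const _).pow 2)).mul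
        P.differentiable.differentiableOn
    · exact ((hdsd.continuousOn.pow N).mul ((hq.continuousOn.sub continuousOn_const).pow 2)).mul
        P.continuous.continuousOn
  have hbound : ∀ z ∈ ball (0 : ℂ) 1, ‖h z‖ ≤ D * (‖q z - q 0‖ ^ 2 / 4) := by
    intro z hz
    have h1 := hds z hz
    have h2 := hC z (ball_subset_closedBall hz)
    calc ‖h z‖ = ‖dslope q 0 z‖ ^ N * ‖q z - q 0‖ ^ 2 * ‖P.eval z‖ := by
          simp only [hh, norm_mul, norm_pow]
      _ ≤ 2 ^ N * ‖q z - q 0‖ ^ 2 * C := by gcongr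
      _ = _ := by rw [hD]; ring
  refine ⟨h, hhd, ?_, ?_, ?_⟩
  · intro z hz
    have hz1 : ‖z‖ = 1 := by simpa using hKT hz
    have hz0 : z ≠ 0 := by rintro rfl; simp at hz1
    have hval : h z = (q z - q 0) ^ (N + 2) * (P.eval z / z ^ N) := by
      simp only [hh]
      rw [dslope_of_ne _ hz0, slope_def_field, sub_zero, div_pow]
      ring
    have h1 : ‖(q z - q 0) ^ (N + 2) - 1‖ < ε / (2 * C) := by
      refine hcont _ (lt_of_le_of_lt ?_ hde)
      have : q z - q 0 - 1 = (q z - 1) - q 0 := by ring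
      rw [this]
      have := norm_sub_le (q z - 1) (q 0)
      have := hqK z hz
      linarith
    have h2 : ‖P.eval z / z ^ N‖ ≤ C := by
      rw [norm_div, norm_pow, hz1, one_pow, div_one]
      exact hC z (sphere_subset_closedBall (hKT hz))
    have h3 : h z - φ z = ((q z - q 0) ^ (N + 2) - 1) * (P.eval z / z ^ N) +
        (P.eval z / z ^ N - φ z) := by rw [hval]; ring
    rw [h3]
    refine (norm_add_le _ _).trans ?_
    rw [norm_mul]
    calc _ ≤ ε / (2 * C) * C + ε / 2 := by
          gcongr
          exact hP z hz
      _ = ε := by field_simp; ring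
  · intro z hz
    have hzb : z ∈ ball (0 : ℂ) 1 := by rw [mem_ball_zero_iff]; linarith
    have h1 : ‖q z - q 0‖ ≤ 2 * d := by
      have := norm_sub_le (q z) (q 0)
      have := hqρ z (hz.trans (le_max_left _ _))
      linarith
    calc ‖h z‖ ≤ D * (‖q z - q 0‖ ^ 2 / 4) := hbound z hzb
      _ ≤ D * ((2 * d) ^ 2 / 4) := by gcongr
      _ = D * (d * d) := by ring
      _ ≤ D * (d * 1) := by gcongr
      _ ≤ ε := by rw [mul_one]; exact hdD
  · intro r hr
    have hhc : ContinuousOn h (ball 0 1) := hhd.continuousOn.mono subset_closure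
    rw [circleLpNorm_eq hp hhc hr]
    refine ENNReal.ofReal_le_ofReal ?_
    have hpt : ∀ z ∈ ball (0 : ℂ) 1, ‖h z‖ ^ p ≤ D ^ p * ((q z).re + d) / 2 := by
      intro z hz
      have hzc := ball_subset_closedBall hz
      have h1 := norm_sub_le (q z) (q 0)
      have h2 := hq1 z hzc
      have h3 := hqre z hzc
      have hx0 : 0 ≤ ‖q z - q 0‖ ^ 2 / 4 := by positivity
      have hx1 : ‖q z - q 0‖ ^ 2 / 4 ≤ 1 := by nlinarith [norm_nonneg (q z - q 0)]
      have hx2 : ‖q z - q 0‖ ^ 2 / 4 ≤ ((q z).re + d) / 2 := by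
        have h4 : ‖q z - q 0‖ ^ 2 ≤ (‖q z‖ + ‖q 0‖) ^ 2 := by gcongr
        nlinarith [sq_nonneg (‖q z‖ - ‖q 0‖), norm_nonneg (q 0)]
      calc ‖h z‖ ^ p ≤ (D * (‖q z - q 0‖ ^ 2 / 4)) ^ p := by
            gcongr
            exact hbound z hz
        _ = D ^ p * (‖q z - q 0‖ ^ 2 / 4) ^ p := Real.mul_rpow hD0.le hx0
        _ ≤ D ^ p * (‖q z - q 0‖ ^ 2 / 4) := by
            gcongr
            exact Real.rpow_le_self_of_le_one hx0 hx1 hp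
        _ ≤ D ^ p * (((q z).re + d) / 2) := by gcongr
        _ = _ := by ring
    have hqc := continuous_comp_circle (hq.continuousOn.mono subset_closure) hr
    have hqrec : Continuous fun θ : ℝ => (q (r * exp (θ * I))).re := continuous_re.comp hqc
    have hI : ∫ θ in (0 : ℝ)..(2 * Real.pi), ‖h (r * exp (θ * I))‖ ^ p ≤ ε ^ p := by
      calc ∫ θ in (0 : ℝ)..(2 * Real.pi), ‖h (r * exp (θ * I))‖ ^ p
          ≤ ∫ θ in (0 : ℝ)..(2 * Real.pi), D ^ p * ((q (r * exp (θ * I))).re + d) / 2 := by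
            refine intervalIntegral.integral_mono hpi.le ?_ ?_ ?_
            · exact ((continuous_comp_circle hhc hr).norm.rpow_const
                (fun _ => Or.inr (by linarith))).intervalIntegrable _ _
            · exact ((continuous_const.mul (hqrec.add continuous_const)).div_const 2).intervalIntegrable _ _
            · exact fun θ => hpt _ (mul_exp_mul_I_mem_ball hr θ)
        _ = D ^ p * (2 * Real.pi * (q 0).re + 2 * Real.pi * d) / 2 := by
            rw [intervalIntegral.integral_div, intervalIntegral.integral_const_mul,
              intervalIntegral.integral_add (hqrec.intervalIntegrable _ _)
                intervalIntegrable_const, integral_re_circle hq hr]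
            simp
        _ ≤ D ^ p * (2 * Real.pi * d + 2 * Real.pi * d) / 2 := by
            have := (re_le_norm (q 0)).trans hq0
            gcongr
        _ = D ^ p * (2 * Real.pi * d) := by ring
        _ ≤ ε ^ p := hdp
    calc _ ≤ (ε ^ p) ^ (1 / p) := by
          refine Real.rpow_le_rpow ?_ hI (by positivity)
          exact intervalIntegral.integral_nonneg hpi.le fun θ _ => by positivity
      _ = ε := by rw [one_div, Real.rpow_rpow_inv hε.le (by linarith)]

theorem circleLpNorm_add_le {p : ℝ} (hp : 1 ≤ p) {f g : ℂ → ℂ}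
    (hf : ContinuousOn f (ball 0 1)) (hg : ContinuousOn g (ball 0 1)) {r : ℝ}
    (hr : r ∈ Ioo (0 : ℝ) 1) :
    circleLpNorm p r (fun z => f z + g z) ≤ circleLpNorm p r f + circleLpNorm p r g :=
  eLpNorm_add_le (continuous_comp_circle hf hr).aestronglyMeasurable
    (continuous_comp_circle hg hr).aestronglyMeasurable (by simpa using hp)

theorem memHp_of_circleLpNorm_le_one {p : ℝ} (hp : 1 ≤ p) {f : ℂ → ℂ}
    (hf : DifferentiableOn ℂ f (ball 0 1))
    (h : ∀ r ∈ Ioo (0 : ℝ) 1, circleLpNorm p r f ≤ 1) : MemHp p f := by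
  refine ⟨hf, 1, ?_⟩
  rintro _ ⟨⟨r, hr⟩, rfl⟩
  have h1 := h r hr
  rw [circleLpNorm_eq hp hf.continuousOn hr, ENNReal.ofReal_le_one] at h1
  have h2 : 0 ≤ ∫ θ in (0 : ℝ)..(2 * Real.pi), ‖f (r * exp (θ * I))‖ ^ p :=
    intervalIntegral.integral_nonneg Real.two_pi_pos.le fun θ _ => by positivity
  refine le_trans ?_ h1
  refine Real.rpow_le_rpow (by positivity) (mul_le_of_le_one_left h2 ?_) (by positivity)
  rw [div_le_one Real.two_pi_pos]
  linarith [Real.pi_gt_three]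

theorem exists_approx_step {p : ℝ} (hp : 1 ≤ p) {K : Set ℂ} (hKc : IsCompact K)
    (hKT : K ⊆ sphere (0 : ℂ) 1) (hKm : arcMeasure K = 0) {ψ : ℂ → ℂ} (hψ : ContinuousOn ψ K)
    {f : ℂ → ℂ} (hf : DiffContOnCl ℂ f (ball 0 1)) {ε ρ σ : ℝ} (hε : 0 < ε) (hρ : ρ < 1)
    (hσ : σ < 1) :
    ∃ (g : ℂ → ℂ) (ρ' : ℝ), DiffContOnCl ℂ g (ball 0 1) ∧ ρ < ρ' ∧ σ < ρ' ∧ ρ' < 1 ∧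
      (∀ z : ℂ, ‖z‖ ≤ ρ → ‖f z - g z‖ ≤ ε) ∧ (∀ z ∈ K, ‖g (ρ' * z) - ψ z‖ ≤ 2 * ε) ∧
      ∀ r ∈ Ioo (0 : ℝ) 1, circleLpNorm p r g ≤ circleLpNorm p r f + ENNReal.ofReal ε := by
  have hcl : closure (ball (0 : ℂ) 1) = closedBall 0 1 := closure_ball _ one_ne_zero
  have hKcl : K ⊆ closedBall (0 : ℂ) 1 := hKT.trans sphere_subset_closedBall
  have hfc := hf.continuousOn
  rw [hcl] at hfc
  obtain ⟨h, hh, hhK, hhρ, hhp⟩ := exists_simultaneous_approx hp hKc hKT hKm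
    (hψ.sub (hfc.mono hKcl)) hε hρ
  have hg : DiffContOnCl ℂ (fun z => f z + h z) (ball 0 1) := hf.add hh
  have hgc := hg.continuousOn
  rw [hcl] at hgc
  obtain ⟨δ, hδ, huc⟩ := Metric.uniformContinuousOn_iff.1
    ((isCompact_closedBall (0 : ℂ) 1).uniformContinuousOn_of_continuous hgc) ε hε
  obtain ⟨ρ', hρ', hρ'1⟩ := exists_between
    (show max (max ρ σ) (max 0 (1 - δ)) < 1 by simp [hρ, hσ, hδ])
  simp only [max_lt_iff] at hρ'
  obtain ⟨⟨h1, h2⟩, h3, h4⟩ := hρ'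
  refine ⟨fun z => f z + h z, ρ', hg, h1, h2, hρ'1, ?_, ?_, ?_⟩
  · intro z hz
    simpa using hhρ z hz
  · intro z hz
    have hz1 : ‖z‖ = 1 := by simpa using hKT hz
    have hmem : (ρ' : ℂ) * z ∈ closedBall (0 : ℂ) 1 := by
      rw [mem_closedBall_zero_iff, norm_mul, hz1, mul_one, norm_real, Real.norm_of_nonneg h3.le]
      exact hρ'1.le
    have h5 := huc _ hmem z (hKcl hz) (by
      have : (ρ' : ℂ) * z - z = ((ρ' - 1 : ℝ) : ℂ) * z := by push_cast; ring
      rw [dist_eq_norm, this, norm_mul, hz1, mul_one, norm_real, Real.norm_eq_abs, abs_lt]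
      constructor <;> linarith)
    rw [dist_eq_norm] at h5
    have h6 := hhK z hz
    have h7 : f (ρ' * z) + h (ρ' * z) - ψ z =
        (f (ρ' * z) + h (ρ' * z) - (f z + h z)) + (h z - (ψ z - f z)) := by ring
    simp only
    rw [h7]
    refine (norm_add_le _ _).trans ?_
    simp only [Pi.sub_apply] at h6
    linarith
  · intro r hr
    refine (circleLpNorm_add_le hp (hf.continuousOn.mono subset_closure)
      (hh.continuousOn.mono subset_closure) hr).trans ?_
    gcongr
    exact hhp r hr

theorem exists_memHp_approx_seq {p : ℝ} (hp : 1 ≤ p) {K : Set ℂ} (hKc : IsCompact K)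
    (hKT : K ⊆ sphere (0 : ℂ) 1) (hKm : arcMeasure K = 0) {ψ : ℕ → ℂ → ℂ}
    (hψ : ∀ n, ContinuousOn (ψ n) K) :
    ∃ (f : ℂ → ℂ) (r : ℕ → ℝ), MemHp p f ∧ (∀ n, r n ∈ Ico (0 : ℝ) 1) ∧ StrictMono r ∧
      Tendsto r atTop (𝓝 1) ∧ ∀ n, ∀ z ∈ K, ‖f (r n * z) - ψ n z‖ ≤ 2 / 2 ^ n := by
  let S := {x : (ℂ → ℂ) × ℝ // DiffContOnCl ℂ x.1 (ball 0 1) ∧ 0 ≤ x.2 ∧ x.2 < 1}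
  have step : ∀ (n : ℕ) (s : S), ∃ s' : S, s.1.2 < s'.1.2 ∧ 1 - 1 / ((n : ℝ) + 1) < s'.1.2 ∧
      (∀ z : ℂ, ‖z‖ ≤ s.1.2 → ‖s.1.1 z - s'.1.1 z‖ ≤ 1 / 2 / 2 ^ n) ∧
      (∀ z ∈ K, ‖s'.1.1 (s'.1.2 * z) - ψ n z‖ ≤ 2 * (1 / 2 / 2 ^ n)) ∧
      ∀ r ∈ Ioo (0 : ℝ) 1,
        circleLpNorm p r s'.1.1 ≤ circleLpNorm p r s.1.1 + ENNReal.ofReal (1 / 2 / 2 ^ n) := by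
    rintro n ⟨⟨f, ρ⟩, hf, hρ0, hρ1⟩
    obtain ⟨g, ρ', hg, h1, h2, h3, h4⟩ := exists_approx_step hp hKc hKT hKm (hψ n) hf
      (ε := 1 / 2 / 2 ^ n) (σ := 1 - 1 / ((n : ℝ) + 1)) (by positivity) hρ1 (by
        have : 0 < 1 / ((n : ℝ) + 1) := by positivity
        linarith)
    exact ⟨⟨⟨g, ρ'⟩, hg, hρ0.trans h1.le, h3⟩, h1, h2, h4⟩
  choose next hnext using step
  let s0 : S := ⟨⟨fun _ => 0, 0⟩, diffContOnCl_const, le_rfl, one_pos⟩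
  let s : ℕ → S := fun n => Nat.rec s0 next n
  set F : ℕ → ℂ → ℂ := fun n => (s n).1.1
  set ρ : ℕ → ℝ := fun n => (s n).1.2
  have hFd : ∀ n, DiffContOnCl ℂ (F n) (ball 0 1) := fun n => (s n).2.1
  have hρ0 : ∀ n, 0 ≤ ρ n := fun n => (s n).2.2.1
  have hρ1 : ∀ n, ρ n < 1 := fun n => (s n).2.2.2
  have hρmono : StrictMono ρ := strictMono_nat_of_lt_succ fun n => (hnext n (s n)).1
  have hρlow : ∀ n : ℕ, 1 - 1 / ((n : ℝ) + 1) < ρ (n + 1) := fun n => (hnext n (s n)).2.1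
  have hFF : ∀ n, ∀ z : ℂ, ‖z‖ ≤ ρ n → ‖F n z - F (n + 1) z‖ ≤ 1 / 2 / 2 ^ n :=
    fun n => (hnext n (s n)).2.2.1
  have hFK : ∀ n, ∀ z ∈ K, ‖F (n + 1) (ρ (n + 1) * z) - ψ n z‖ ≤ 2 * (1 / 2 / 2 ^ n) :=
    fun n => (hnext n (s n)).2.2.2.1
  have hFp : ∀ n, ∀ r ∈ Ioo (0 : ℝ) 1,
      circleLpNorm p r (F (n + 1)) ≤ circleLpNorm p r (F n) + ENNReal.ofReal (1 / 2 / 2 ^ n) :=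
    fun n => (hnext n (s n)).2.2.2.2
  have hρlim : Tendsto (fun n => ρ (n + 1)) atTop (𝓝 1) := by
    have h1 : Tendsto (fun n : ℕ => 1 - 1 / ((n : ℝ) + 1)) atTop (𝓝 (1 - 0)) :=
      tendsto_const_nhds.sub tendsto_one_div_add_atTop_nhds_zero_nat
    rw [sub_zero] at h1
    exact tendsto_of_tendsto_of_tendsto_of_le_of_le h1 tendsto_const_nhds
      (fun n => (hρlow n).le) (fun n => (hρ1 (n + 1)).le)
  have hlt : ∀ z ∈ ball (0 : ℂ) 1, ∃ m, ‖z‖ < ρ m := by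
    intro z hz
    obtain ⟨n, hn⟩ := (hρlim.eventually_const_lt (mem_ball_zero_iff.1 hz)).exists
    exact ⟨n + 1, hn⟩
  have hgeom : ∀ m, ∀ z : ℂ, ‖z‖ ≤ ρ m →
      ∀ n, dist (F (n + m) z) (F (n + 1 + m) z) ≤ 1 / 2 ^ m / 2 / 2 ^ n := by
    intro m z hz n
    rw [dist_eq_norm]
    have h1 := hFF (n + m) z (hz.trans (hρmono.monotone (Nat.le_add_left m n)))
    rw [show n + 1 + m = n + m + 1 by ring]
    refine h1.trans_eq ?_
    rw [pow_add]
    field_simp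
  set f : ℂ → ℂ := fun z => limUnder atTop fun n => F n z
  have hlim : ∀ z ∈ ball (0 : ℂ) 1, Tendsto (fun n => F n z) atTop (𝓝 (f z)) := by
    intro z hz
    obtain ⟨m, hm⟩ := hlt z hz
    obtain ⟨a, ha⟩ := cauchySeq_tendsto_of_complete
      (cauchySeq_of_le_geometric_two (f := fun n => F (n + m) z) (hgeom m z hm.le))
    exact tendsto_nhds_limUnder ⟨a, (tendsto_add_atTop_iff_nat (f := fun n => F n z) m).1 ha⟩
  have hdist : ∀ m, ∀ z : ℂ, ‖z‖ ≤ ρ m → dist (F m z) (f z) ≤ 1 / 2 ^ m := by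
    intro m z hz
    have hzb : z ∈ ball (0 : ℂ) 1 := mem_ball_zero_iff.2 (hz.trans_lt (hρ1 m))
    have := dist_le_of_le_geometric_two_of_tendsto₀ (f := fun n => F (n + m) z)
      (hgeom m z hz) ((tendsto_add_atTop_iff_nat (f := fun n => F n z) m).2 (hlim z hzb))
    simpa using this
  have hpow : Tendsto (fun n : ℕ => (1 : ℝ) / 2 ^ n) atTop (𝓝 0) := by
    simpa using tendsto_pow_atTop_nhds_zero_of_lt_one (r := (1 / 2 : ℝ)) (by norm_num) (by norm_num)
  have hfd : DifferentiableOn ℂ f (ball 0 1) := by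
    refine TendstoLocallyUniformlyOn.differentiableOn (φ := atTop) (F := F) ?_
      (Eventually.of_forall fun n => (hFd n).differentiableOn) isOpen_ball
    rw [Metric.tendstoLocallyUniformlyOn_iff]
    intro e he z hz
    obtain ⟨m, hm⟩ := hlt z hz
    refine ⟨ball 0 (ρ m), mem_nhdsWithin_of_mem_nhds
      (isOpen_ball.mem_nhds (mem_ball_zero_iff.2 hm)), ?_⟩
    filter_upwards [eventually_ge_atTop m, hpow.eventually_lt_const he] with n hn hne y hy
    rw [dist_comm]
    refine (hdist n y ?_).trans_lt hne
    exact (mem_ball_zero_iff.1 hy).le.trans (hρmono.monotone hn)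
  have hnorm : ∀ r ∈ Ioo (0 : ℝ) 1, ∀ n,
      circleLpNorm p r (F n) ≤ ENNReal.ofReal (1 - 1 / 2 ^ n) := by
    intro r hr n
    induction n with
    | zero =>
      have : circleLpNorm p r (F 0) = 0 := eLpNorm_zero
      simp [this]
    | succ n ih =>
      have h1 : (1 : ℝ) / 2 ^ n ≤ 1 := by
        rw [div_le_one (by positivity)]
        exact one_le_pow₀ one_le_two
      calc _ ≤ circleLpNorm p r (F n) + ENNReal.ofReal (1 / 2 / 2 ^ n) := hFp n r hr
        _ ≤ ENNReal.ofReal (1 - 1 / 2 ^ n) + ENNReal.ofReal (1 / 2 / 2 ^ n) := by gcongr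
        _ = ENNReal.ofReal (1 - 1 / 2 ^ (n + 1)) := by
          rw [← ENNReal.ofReal_add (by linarith) (by positivity)]
          congr 1
          rw [pow_succ]
          field_simp
          ring
  refine ⟨f, fun n => ρ (n + 1), memHp_of_circleLpNorm_le_one hp hfd fun r hr => ?_,
    fun n => ⟨hρ0 (n + 1), hρ1 (n + 1)⟩, hρmono.comp (strictMono_id.add_const 1), hρlim, ?_⟩
  · refine Lp.eLpNorm_le_of_ae_tendsto (u := atTop) (C := 1)
      (f := fun n (θ : ℝ) => F n (r * exp (θ * I))) (Eventually.of_forall fun n => ?_)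
      (fun n => (continuous_comp_circle ((hFd n).continuousOn.mono subset_closure)
        hr).aestronglyMeasurable)
      (Eventually.of_forall fun θ => hlim _ (mul_exp_mul_I_mem_ball hr θ))
    refine (hnorm r hr n).trans ?_
    rw [ENNReal.ofReal_le_one]
    have : (0 : ℝ) < 1 / 2 ^ n := by positivity
    linarith
  · intro n z hz
    have hz1 : ‖z‖ = 1 := by simpa using hKT hz
    have h1 := hdist (n + 1) (ρ (n + 1) * z) (by
      rw [norm_mul, hz1, mul_one, norm_real]; exact (Real.norm_of_nonneg (hρ0 (n + 1))).le)
    have h2 := hFK n z hz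
    rw [dist_comm, dist_eq_norm] at h1
    have h3 : f (ρ (n + 1) * z) - ψ n z = (f (ρ (n + 1) * z) - F (n + 1) (ρ (n + 1) * z)) +
        (F (n + 1) (ρ (n + 1) * z) - ψ n z) := by ring
    simp only
    rw [h3]
    refine (norm_add_le _ _).trans ((add_le_add h1 h2).trans ?_)
    rw [pow_succ]
    have : (0 : ℝ) < 1 / 2 ^ n := by positivity
    have h4 : (1 : ℝ) / (2 ^ n * 2) + 2 * (1 / 2 / 2 ^ n) = 3 / 2 * (1 / 2 ^ n) := by
      field_simp
      ring
    have h5 : (2 : ℝ) / 2 ^ n = 2 * (1 / 2 ^ n) := by ring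
    rw [h4, h5]
    linarith

/-- For compact `K ⊆ 𝕋` of zero arc length there exists `f ∈ H^p(𝔻)` whose radial limits
approximate every continuous function on `K`. -/
theorem statement_19 (p : ℝ) (hp : 1 ≤ p)
    (K : Set ℂ) (hKc : IsCompact K) (hKT : K ⊆ Metric.sphere (0:ℂ) 1)
    (hKm : arcMeasure K = 0) :
    ∃ f : ℂ → ℂ, MemHp p f ∧
      ∀ φ : ℂ → ℂ, ContinuousOn φ K →
        ∃ r : ℕ → ℝ, (∀ n, r n ∈ Set.Ico (0:ℝ) 1) ∧ StrictMono r ∧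
          Filter.Tendsto r Filter.atTop (nhds 1) ∧
          Filter.Tendsto (fun n => ⨆ ζ ∈ K, ‖f (((r n : ℝ) : ℂ) * ζ) - φ ζ‖)
            Filter.atTop (nhds 0) := by
  have : CompactSpace K := isCompact_iff_compactSpace.1 hKc
  set e := TopologicalSpace.denseSeq C(K, ℂ)
  set E : ℕ → ℂ → ℂ := fun i => Function.extend Subtype.val (e i) 0
  have hEe : ∀ i (z : K), E i z = e i z := fun i z =>
    Subtype.val_injective.extend_apply (e i) 0 z
  have hEc : ∀ i, ContinuousOn (E i) K := by
    intro i
    rw [continuousOn_iff_continuous_domRestrict]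
    exact (e i).continuous.congr fun z => (hEe i z).symm
  obtain ⟨f, r, hf, hr, hrmono, hrlim, hfr⟩ := exists_memHp_approx_seq hp hKc hKT hKm
    (ψ := fun n => E n.unpair.1) fun n => hEc _
  refine ⟨f, hf, fun φ hφ => ?_⟩
  have hfreq : ∀ k : ℕ, ∃ᶠ n in atTop, ∀ z ∈ K, ‖f (r n * z) - φ z‖ ≤ 2 / ((k : ℝ) + 1) := by
    intro k
    have hk : 0 < 1 / ((k : ℝ) + 1) := by positivity
    obtain ⟨i, hi⟩ := (TopologicalSpace.denseRange_denseSeq C(K, ℂ)).exists_dist_lt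
      (⟨K.domRestrict φ, continuousOn_iff_continuous_domRestrict.1 hφ⟩ : C(K, ℂ)) hk
    have hsmall : ∀ᶠ n : ℕ in atTop, (2 : ℝ) / 2 ^ n < 1 / ((k : ℝ) + 1) := by
      have h1 : Tendsto (fun n : ℕ => 2 * (1 / 2 : ℝ) ^ n) atTop (𝓝 (2 * 0)) :=
        (tendsto_pow_atTop_nhds_zero_of_lt_one (by norm_num) (by norm_num)).const_mul 2
      rw [mul_zero] at h1
      filter_upwards [h1.eventually_lt_const hk] with n hn
      simpa [div_eq_mul_inv] using hn
    have hi_freq : ∃ᶠ n : ℕ in atTop, n.unpair.1 = i :=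
      frequently_atTop.2 fun N => ⟨Nat.pair i N, Nat.right_le_pair i N, by simp⟩
    refine (hi_freq.and_eventually hsmall).mono ?_
    rintro n ⟨rfl, hn⟩ z hz
    have h1 := hfr n z hz
    have h2 := (ContinuousMap.dist_lt_iff hk).1 hi ⟨z, hz⟩
    rw [dist_comm, dist_eq_norm] at h2
    have h3 : f (r n * z) - φ z =
        (f (r n * z) - E n.unpair.1 z) + (E n.unpair.1 z - φ z) := by ring
    rw [h3]
    refine (norm_add_le _ _).trans ?_
    have h4 : ‖E n.unpair.1 z - φ z‖ < 1 / ((k : ℝ) + 1) := by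
      rw [hEe _ ⟨z, hz⟩]
      exact h2
    have h5 : 2 / ((k : ℝ) + 1) = 1 / ((k : ℝ) + 1) + 1 / ((k : ℝ) + 1) := by ring
    linarith
  obtain ⟨u, hu, hfu⟩ := extraction_forall_of_frequently hfreq
  refine ⟨r ∘ u, fun n => hr _, hrmono.comp hu, hrlim.comp hu.tendsto_atTop, ?_⟩
  refine squeeze_zero (g := fun k : ℕ => 2 * (1 / ((k : ℝ) + 1)))
    (fun k => Real.iSup_nonneg fun z => Real.iSup_nonneg fun _ => norm_nonneg _) (fun k => ?_) ?_
  · have hk : (0 : ℝ) ≤ 2 * (1 / ((k : ℝ) + 1)) := by positivity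
    refine Real.iSup_le (fun z => Real.iSup_le (fun hz => ?_) hk) hk
    rw [mul_one_div]
    exact hfu k z hz
  · simpa using (tendsto_one_div_add_atTop_nhds_zero_nat (𝕜 := ℝ)).const_mul 2
end
end
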